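/- Existence under a one-sided bound when ρ < 0: Let θ ∈ (0,1), so ρ = (θ-1)/θ < 0. Let Λ ∈ L̂^θ_{++} and suppose U is a nonnegative progressively measurable process with U ≤ K Λ for some constant K ∈ (0,∞). Then the operator F_U defined by F_U(W)_t := E[∫_t^∞ h_EZ(U_s, W_s) ds | 𝓕_t] has a fixed point W with E[∫_0^∞ h_EZ(U_s,W_s) ds] < ∞, and this fixed point is unique among all such fixed points up to indistinguishability. -/

import Mathlib

open MeasureTheory Filter Set

noncomputable section

namespace EZSDU

variable {Ω : Type*} {m : MeasurableSpace Ω}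

/-- Conditional expectation of a `[0,∞]`-valued random variable, defined as the monotone
limit of the conditional expectations of its truncations. -/
def condExpENN (P : Measure Ω) (mm : MeasurableSpace Ω) (X : Ω → ENNReal) : Ω → ENNReal :=
  fun ω => ⨆ k : ℕ, ENNReal.ofReal ((P[(fun ω' => (min (X ω') (k : ENNReal)).toReal) | mm]) ω)

/-- The extended Epstein–Zin aggregator `h_EZ : [0,∞]² → [0,∞]`: for `u ∈ [0,∞)` it equals
`u · w^ρ` (with the conventions `0^ρ = ∞` and `∞^ρ = 0` for `ρ < 0`, so that
`h_EZ(u,w) = w^ρ` for `u ∈ (0,∞)`, `w ∈ {0,∞}`, and `h_EZ(0,w) = 0`), and `h_EZ(∞,w) = ∞`. -/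
def hEZ (ρ : ℝ) (u w : ENNReal) : ENNReal :=
  if u = ⊤ then ⊤ else u * w ^ ρ

/-- `U ∈ 𝕆(Y)`: `U` is a nonnegative progressively measurable process with
`kY ≤ U ≤ KY` for some constants `0 < k ≤ K < ∞`. -/
def InOrder (P : Measure Ω) (ℱ : Filtration ℝ m) (Y U : ℝ → Ω → ℝ) : Prop :=
  ProgMeasurable ℱ U ∧ (∀ t ω, 0 ≤ t → 0 ≤ U t ω) ∧
  ∃ k K : ℝ, 0 < k ∧ k ≤ K ∧
    ∀ t : ℝ, 0 ≤ t → ∀ᵐ ω ∂P, k * Y t ω ≤ U t ω ∧ U t ω ≤ K * Y t ω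

/-- `Λ ∈ L^θ_{++}`: a strictly positive progressively measurable process with
`E[∫₀^∞ Λ_s^θ ds] < ∞`. -/
def MemLtheta (P : Measure Ω) (ℱ : Filtration ℝ m) (θ : ℝ) (Λ : ℝ → Ω → ℝ) : Prop :=
  ProgMeasurable ℱ Λ ∧ (∀ t ω, 0 < Λ t ω) ∧
  (∫⁻ ω, (∫⁻ s in Set.Ioi (0:ℝ), ENNReal.ofReal (Λ s ω ^ θ)) ∂P) < ⊤

/-- The process `I^Λ_t = E[∫_t^∞ Λ_s^θ ds | 𝓕_t]`. -/
def Iproc (P : Measure Ω) (ℱ : Filtration ℝ m) (θ : ℝ) (Λ : ℝ → Ω → ℝ) : ℝ → Ω → ℝ :=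
  fun t => P[(fun ω => ∫ s in Set.Ioi t, Λ s ω ^ θ) | ℱ t]

/-- `Λ ∈ L̂^θ_{++}`: `Λ ∈ L^θ_{++}` and `Λ^θ ∈ 𝕆(I^Λ)`. -/
def MemLthetaHat (P : Measure Ω) (ℱ : Filtration ℝ m) (θ : ℝ) (Λ : ℝ → Ω → ℝ) : Prop :=
  MemLtheta P ℱ θ Λ ∧ InOrder P ℱ (Iproc P ℱ θ Λ) fun t ω => Λ t ω ^ θ

open scoped ENNReal

/-- A `[0,∞]`-valued process is progressive iff for each time `i` the process frozen at `i` is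
jointly measurable with respect to `ℱ i`. -/
def IsProg (ℱ : Filtration ℝ m) (f : ℝ → Ω → ℝ≥0∞) : Prop :=
  ∀ i : ℝ, @Measurable (ℝ × Ω) ℝ≥0∞ (@Prod.instMeasurableSpace ℝ Ω _ (ℱ i)) _
    fun p => f (min p.1 i) p.2

theorem IsProg.of_isStronglyProgressive {ℱ : Filtration ℝ m} {E : Type*} [TopologicalSpace E]
    [TopologicalSpace.PseudoMetrizableSpace E] [MeasurableSpace E] [BorelSpace E]
    {f : ℝ → Ω → E} (hf : IsStronglyProgressive ℱ f) {g : E → ℝ≥0∞} (hg : Measurable g) :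
    IsProg ℱ fun t ω => g (f t ω) := by
  intro i
  let _ : MeasurableSpace Ω := ℱ i
  have h := hg.comp (hf i).measurable
  have h2 : Measurable (fun p : ℝ × Ω => ((⟨min p.1 i, Set.mem_Iic.2 (min_le_right _ _)⟩ : Set.Iic i), p.2)) :=
    Measurable.prodMk (Measurable.subtype_mk (measurable_fst.min measurable_const)) measurable_snd
  exact h.comp h2

theorem IsProg.isStronglyProgressive {ℱ : Filtration ℝ m} {f : ℝ → Ω → ℝ≥0∞} (hf : IsProg ℱ f) :
    IsStronglyProgressive ℱ f := by
  intro i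
  let _ : MeasurableSpace Ω := ℱ i
  have h2 : Measurable (fun p : Set.Iic i × Ω => ((p.1 : ℝ), p.2)) := by fun_prop
  have h := (hf i).comp h2
  have h3 : (fun p : Set.Iic i × Ω => f p.1 p.2) =
      (fun p : ℝ × Ω => f (min p.1 i) p.2) ∘ fun p : Set.Iic i × Ω => ((p.1 : ℝ), p.2) := by
    funext p
    have : min (p.1 : ℝ) i = p.1 := min_eq_left p.1.2
    simp [this]
  rw [h3]
  exact h.stronglyMeasurable

theorem IsProg.measurable_apply {ℱ : Filtration ℝ m} {f : ℝ → Ω → ℝ≥0∞} (hf : IsProg ℱ f)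
    (t : ℝ) : Measurable[ℱ t] (f t) := by
  let _ : MeasurableSpace Ω := ℱ t
  have h2 : Measurable (fun ω : Ω => (t, ω)) := measurable_prodMk_left
  have := (hf t).comp h2
  simpa [Function.comp_def] using this

theorem IsProg.measurable_uncurry {ℱ : Filtration ℝ m} {f : ℝ → Ω → ℝ≥0∞} (hf : IsProg ℱ f) :
    Measurable fun p : ℝ × Ω => f p.1 p.2 := by
  refine measurable_of_tendsto_metrizable (f := fun (n : ℕ) (p : ℝ × Ω) => f (min p.1 n) p.2)
    (fun n => (hf n).mono (sup_le_sup le_rfl (MeasurableSpace.comap_mono (ℱ.le n))) le_rfl) ?_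
  rw [tendsto_pi_nhds]
  intro p
  obtain ⟨N, hN⟩ := exists_nat_ge p.1
  refine tendsto_const_nhds.congr' ?_
  filter_upwards [eventually_ge_atTop N] with n hn
  rw [min_eq_left (hN.trans (by exact_mod_cast hn))]

theorem IsProg.measurable_path {ℱ : Filtration ℝ m} {f : ℝ → Ω → ℝ≥0∞} (hf : IsProg ℱ f)
    (ω : Ω) : Measurable fun t => f t ω :=
  hf.measurable_uncurry.comp (measurable_id.prodMk measurable_const)

theorem IsProg.measurable_apply' {ℱ : Filtration ℝ m} {f : ℝ → Ω → ℝ≥0∞} (hf : IsProg ℱ f)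
    (t : ℝ) : Measurable (f t) :=
  (hf.measurable_apply t).mono (ℱ.le t) le_rfl

theorem IsProg.of_deterministic {ℱ : Filtration ℝ m} {f : ℝ → ℝ≥0∞} (hf : Measurable f) :
    IsProg ℱ fun t _ => f t := by
  intro i
  let _ : MeasurableSpace Ω := ℱ i
  exact hf.comp (measurable_fst.min measurable_const)

theorem IsProg.comp {ℱ : Filtration ℝ m} {f : ℝ → Ω → ℝ≥0∞} (hf : IsProg ℱ f) {g : ℝ≥0∞ → ℝ≥0∞}
    (hg : Measurable g) : IsProg ℱ fun t ω => g (f t ω) :=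
  fun i => @Measurable.comp _ _ _ (_) _ _ _ _ hg (hf i)

theorem IsProg.comp₂ {ℱ : Filtration ℝ m} {f₁ f₂ : ℝ → Ω → ℝ≥0∞} (h₁ : IsProg ℱ f₁)
    (h₂ : IsProg ℱ f₂) {g : ℝ≥0∞ → ℝ≥0∞ → ℝ≥0∞} (hg : Measurable (Function.uncurry g)) :
    IsProg ℱ fun t ω => g (f₁ t ω) (f₂ t ω) := by
  intro i
  let _ : MeasurableSpace Ω := ℱ i
  exact hg.comp ((h₁ i).prodMk (h₂ i))

theorem IsProg.add {ℱ : Filtration ℝ m} {f₁ f₂ : ℝ → Ω → ℝ≥0∞} (h₁ : IsProg ℱ f₁)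
    (h₂ : IsProg ℱ f₂) : IsProg ℱ fun t ω => f₁ t ω + f₂ t ω :=
  h₁.comp₂ h₂ (g := fun x y => x + y) (by fun_prop)

theorem IsProg.mul {ℱ : Filtration ℝ m} {f₁ f₂ : ℝ → Ω → ℝ≥0∞} (h₁ : IsProg ℱ f₁)
    (h₂ : IsProg ℱ f₂) : IsProg ℱ fun t ω => f₁ t ω * f₂ t ω :=
  h₁.comp₂ h₂ (g := fun x y => x * y) (by fun_prop)

theorem IsProg.sub {ℱ : Filtration ℝ m} {f₁ f₂ : ℝ → Ω → ℝ≥0∞} (h₁ : IsProg ℱ f₁)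
    (h₂ : IsProg ℱ f₂) : IsProg ℱ fun t ω => f₁ t ω - f₂ t ω :=
  h₁.comp₂ h₂ (g := fun x y => x - y) (by fun_prop)

theorem IsProg.div {ℱ : Filtration ℝ m} {f₁ f₂ : ℝ → Ω → ℝ≥0∞} (h₁ : IsProg ℱ f₁)
    (h₂ : IsProg ℱ f₂) : IsProg ℱ fun t ω => f₁ t ω / f₂ t ω :=
  h₁.comp₂ h₂ (g := fun x y => x / y) (by fun_prop)

theorem IsProg.max {ℱ : Filtration ℝ m} {f₁ f₂ : ℝ → Ω → ℝ≥0∞} (h₁ : IsProg ℱ f₁)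
    (h₂ : IsProg ℱ f₂) : IsProg ℱ fun t ω => f₁ t ω ⊔ f₂ t ω :=
  h₁.comp₂ h₂ (g := fun x y => x ⊔ y) (by fun_prop)

theorem IsProg.iSup {ℱ : Filtration ℝ m} {f : ℕ → ℝ → Ω → ℝ≥0∞} (h : ∀ n, IsProg ℱ (f n)) :
    IsProg ℱ fun t ω => ⨆ n, f n t ω := by
  intro i
  let _ : MeasurableSpace Ω := ℱ i
  exact Measurable.iSup fun n => h n i

theorem IsProg.iInf {ℱ : Filtration ℝ m} {f : ℕ → ℝ → Ω → ℝ≥0∞} (h : ∀ n, IsProg ℱ (f n)) :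
    IsProg ℱ fun t ω => ⨅ n, f n t ω := by
  intro i
  let _ : MeasurableSpace Ω := ℱ i
  exact Measurable.iInf fun n => h n i

theorem IsProg.limsup {ℱ : Filtration ℝ m} {f : ℕ → ℝ → Ω → ℝ≥0∞} (h : ∀ n, IsProg ℱ (f n)) :
    IsProg ℱ fun t ω => Filter.limsup (fun n => f n t ω) atTop := by
  intro i
  let _ : MeasurableSpace Ω := ℱ i
  exact Measurable.limsup fun n => h n i

theorem IsProg.lintegral_Ioc {ℱ : Filtration ℝ m} {f : ℝ → Ω → ℝ≥0∞} (hf : IsProg ℱ f) (a : ℝ) :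
    IsProg ℱ fun t ω => ∫⁻ s in Ioc a t, f s ω := by
  intro i
  let _ : MeasurableSpace Ω := ℱ i
  have h1 : Measurable (fun q : (ℝ × Ω) × ℝ =>
      if a < q.2 ∧ q.2 ≤ min q.1.1 i then f (min q.2 i) q.1.2 else 0) := by
    refine Measurable.ite ?_ ?_ measurable_const
    · exact (measurableSet_lt measurable_const measurable_snd).inter
        (measurableSet_le measurable_snd (by fun_prop))
    · exact (hf i).comp (g := fun p : ℝ × Ω => f (min p.1 i) p.2)
        (f := fun q : (ℝ × Ω) × ℝ => (q.2, q.1.2)) (by fun_prop)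
  have h2 := h1.lintegral_prod_right' (ν := volume)
  convert h2 using 2 with p
  change ∫⁻ s in Ioc a (min p.1 i), f s p.2 = ∫⁻ s, if a < s ∧ s ≤ min p.1 i then f (min s i) p.2 else 0
  rw [← lintegral_indicator measurableSet_Ioc]
  refine lintegral_congr fun s => ?_
  by_cases hs : a < s ∧ s ≤ min p.1 i
  · rw [Set.indicator_of_mem (show s ∈ Ioc a (min p.1 i) from hs), if_pos hs,
      min_eq_left (hs.2.trans (min_le_right _ _))]
  · rw [Set.indicator_of_notMem (show s ∉ Ioc a (min p.1 i) from hs), if_neg hs]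

theorem measurable_condExpENN (P : Measure Ω) (mm : MeasurableSpace Ω) (X : Ω → ℝ≥0∞) :
    Measurable[mm] (condExpENN P mm X) := by
  unfold condExpENN
  exact Measurable.iSup fun k => ENNReal.measurable_ofReal.comp
    (stronglyMeasurable_condExp (m := mm) (μ := P)).measurable

theorem condExpENN_ae_eq_condLExp (P : Measure Ω) [IsProbabilityMeasure P] {mm : MeasurableSpace Ω}
    (hm : mm ≤ m) {X : Ω → ℝ≥0∞} (hX : Measurable[m] X) :
    condExpENN P mm X =ᵐ[P] P⁻[X|mm] := by
  refine ae_eq_condLExp hm P X (measurable_condExpENN P mm X) fun s hs => ?_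
  have hbd (k : ℕ) (ω : Ω) : ‖(min (X ω) (k : ℝ≥0∞)).toReal‖ ≤ k := by
    rw [Real.norm_of_nonneg ENNReal.toReal_nonneg]
    exact ENNReal.toReal_le_of_le_ofReal (by positivity) (by simp)
  have hint (k : ℕ) : Integrable (fun ω => (min (X ω) (k : ℝ≥0∞)).toReal) P :=
    Integrable.of_bound ((hX.min (@measurable_const _ _ _ m _)).ennreal_toReal.aestronglyMeasurable) (k : ℝ)
      (ae_of_all _ (hbd k))
  unfold condExpENN
  rw [lintegral_iSup_ae]
  · have hk (k : ℕ) : ∫⁻ ω in s, ENNReal.ofReal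
        ((P[(fun ω' => (min (X ω') (k : ℝ≥0∞)).toReal) | mm]) ω) ∂P
        = ∫⁻ ω in s, min (X ω) k ∂P := by
      rw [← ofReal_integral_eq_lintegral_ofReal integrable_condExp.integrableOn,
        setIntegral_condExp hm (hint k) hs,
        ofReal_integral_eq_lintegral_ofReal (hint k).integrableOn]
      · refine lintegral_congr fun ω => ENNReal.ofReal_toReal ?_
        exact (lt_of_le_of_lt (min_le_right _ _) (ENNReal.natCast_lt_top k)).ne
      · exact ae_of_all _ fun ω => ENNReal.toReal_nonneg
      · exact ae_restrict_of_ae (condExp_nonneg (ae_of_all _ fun ω => ENNReal.toReal_nonneg))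
    simp_rw [hk]
    rw [← lintegral_iSup]
    · refine lintegral_congr fun ω => ?_
      refine le_antisymm (iSup_le fun k => min_le_left _ _) ?_
      refine le_of_forall_lt fun c hc => ?_
      obtain ⟨n, hn⟩ := ENNReal.exists_nat_gt (ne_top_of_lt hc)
      exact lt_of_lt_of_le (lt_min hc hn) (le_iSup (fun k : ℕ => min (X ω) (k : ℝ≥0∞)) n)
    · exact fun k => hX.min (@measurable_const _ _ _ m _)
    · intro i j hij ω
      exact min_le_min le_rfl (by exact_mod_cast hij)
  · exact fun k => ((stronglyMeasurable_condExp (m := mm) (μ := P)).measurable.mono hm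
      le_rfl).ennreal_ofReal
  · intro k
    refine ae_restrict_of_ae ?_
    have h := condExp_mono (μ := P) (m := mm) (hint k) (hint (k + 1)) (ae_of_all _ fun ω => by
      refine ENNReal.toReal_mono ?_ (min_le_min le_rfl (by simp))
      exact (lt_of_le_of_lt (min_le_right _ _) (ENNReal.natCast_lt_top (k+1))).ne)
    filter_upwards [h] with ω hω
    exact ENNReal.ofReal_le_ofReal hω

theorem lintegral_mul_condLExp (P : Measure Ω) [IsProbabilityMeasure P] {mm : MeasurableSpace Ω}
    (hm : mm ≤ m) {X : Ω → ℝ≥0∞} (hX : Measurable[m] X) {Z : Ω → ℝ≥0∞} (hZ : Measurable[mm] Z) :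
    ∫⁻ ω, Z ω * (P⁻[X|mm]) ω ∂P = ∫⁻ ω, Z ω * X ω ∂P := by
  have hY : Measurable[m] (P⁻[X|mm]) := measurable_condLExp' mm P X
  have key (c : ℝ≥0∞) {s : Set Ω} (hs : MeasurableSet[m] s) (Y : Ω → ℝ≥0∞) (hY : Measurable[m] Y) :
      ∫⁻ ω, s.indicator (fun _ => c) ω * Y ω ∂P = c * ∫⁻ ω in s, Y ω ∂P := by
    rw [← lintegral_indicator hs, ← lintegral_const_mul _ (hY.indicator hs)]
    refine lintegral_congr fun ω => ?_
    by_cases h : ω ∈ s <;> simp [h]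
  refine @Measurable.ennreal_induction Ω mm (fun Z => ∫⁻ ω, Z ω * (P⁻[X|mm]) ω ∂P = ∫⁻ ω, Z ω * X ω ∂P) ?_ ?_ ?_ Z hZ
  · intro c s hs
    rw [key c (hm s hs) _ hY, key c (hm s hs) _ hX, setLIntegral_condLExp hm P X hs]
  · intro f g _ hf hg h1 h2
    have hf' := hf.mono hm le_rfl
    simp only [Pi.add_apply, add_mul]
    rw [lintegral_add_left (f := fun ω => f ω * (P⁻[X|mm]) ω) (hf'.mul hY),
      lintegral_add_left (f := fun ω => f ω * X ω) (hf'.mul hX), h1, h2]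
  · intro f hf hmono h
    simp only [ENNReal.iSup_mul]
    rw [lintegral_iSup (f := fun n ω => f n ω * (P⁻[X|mm]) ω)
      (fun n => ((hf n).mono hm le_rfl).mul hY)
      (fun i j hij ω => mul_le_mul_left (hmono hij ω) _),
      lintegral_iSup (f := fun n ω => f n ω * X ω) (fun n => ((hf n).mono hm le_rfl).mul hX)
      (fun i j hij ω => mul_le_mul_left (hmono hij ω) _)]
    simp_rw [h]

theorem integral_sq_condExp_sub (P : Measure Ω) [IsProbabilityMeasure P] (ℱ : Filtration ℝ m)
    {X : Ω → ℝ} {k : NNReal} (hk : ∀ ω, |X ω| ≤ k) {s t : ℝ} (hst : s ≤ t) :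
    ∫ ω, ((P[X|ℱ t]) ω - (P[X|ℱ s]) ω) ^ 2 ∂P =
      ∫ ω, (P[X|ℱ t]) ω ^ 2 ∂P - ∫ ω, (P[X|ℱ s]) ω ^ 2 ∂P := by
  have hb (r : ℝ) : ∀ᵐ ω ∂P, ‖(P[X|ℱ r]) ω‖ ≤ k :=
    ae_bdd_abs_condExp_of_ae_bdd_abs (ae_of_all _ hk)
  have hm (r : ℝ) : AEStronglyMeasurable (P[X|ℱ r]) P := integrable_condExp.1
  have hi (r r' : ℝ) : Integrable (fun ω => (P[X|ℱ r]) ω * (P[X|ℱ r']) ω) P :=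
    integrable_condExp.bdd_mul (hm r) (hb r)
  have hcross : ∫ ω, (P[X|ℱ s]) ω * (P[X|ℱ t]) ω ∂P = ∫ ω, (P[X|ℱ s]) ω * (P[X|ℱ s]) ω ∂P := by
    have h1 := condExp_stronglyMeasurable_mul_of_bound (μ := P) (ℱ.le s)
      (stronglyMeasurable_condExp (m := ℱ s) (μ := P) (f := X))
      (integrable_condExp (m := ℱ t) (μ := P) (f := X)) k (hb s)
    have h2 := condExp_condExp_of_le (μ := P) (f := X) (ℱ.mono hst) (ℱ.le t)
    have h3 := integral_condExp (μ := P) (ℱ.le s) (f := (P[X|ℱ s]) * (P[X|ℱ t]))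
    change ∫ ω, ((P[X|ℱ s]) * (P[X|ℱ t])) ω ∂P = _
    rw [← h3]
    refine integral_congr_ae ?_
    filter_upwards [h1, h2] with ω h1 h2
    rw [h1, Pi.mul_apply, h2]
  have e : ∀ ω, ((P[X|ℱ t]) ω - (P[X|ℱ s]) ω) ^ 2 = ((P[X|ℱ t]) ω * (P[X|ℱ t]) ω -
      2 * ((P[X|ℱ s]) ω * (P[X|ℱ t]) ω)) + (P[X|ℱ s]) ω * (P[X|ℱ s]) ω := fun ω => by ring
  simp_rw [e, pow_two]
  have hi3 : Integrable (fun ω => (P[X|ℱ t]) ω * (P[X|ℱ t]) ω -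
      2 * ((P[X|ℱ s]) ω * (P[X|ℱ t]) ω)) P := (hi t t).sub ((hi s t).const_mul 2)
  rw [integral_add hi3 (hi s s),
    integral_sub (hi t t) ((hi s t).const_mul 2), integral_const_mul, hcross]
  ring

theorem IsProg.comp_floor {ℱ : Filtration ℝ m} {M : ℝ → Ω → ℝ≥0∞}
    (hM : ∀ t, Measurable[ℱ t] (M t)) {c : ℝ} (hc : 0 < c) :
    IsProg ℱ fun t ω => M (⌊c * t⌋ / c) ω := by
  intro i
  let _ : MeasurableSpace Ω := ℱ i
  have h1 : Measurable fun q : ℤ × Ω => M (min (q.1 / c) i) q.2 := by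
    refine measurable_from_prod_countable_right fun j => ?_
    exact (hM (min (j / c) i)).mono (ℱ.mono (min_le_right _ _)) le_rfl
  have h2 : Measurable fun p : ℝ × Ω => (⌊c * min p.1 i⌋, p.2) := by
    refine Measurable.prodMk (Int.measurable_floor.comp (by fun_prop)) measurable_snd
  convert h1.comp h2 using 2 with p
  have : (⌊c * min p.1 i⌋ : ℝ) / c ≤ i := by
    rw [div_le_iff₀ hc]
    refine (Int.floor_le _).trans ?_
    rw [mul_comm]
    gcongr
    exact min_le_right _ _
  simp [min_eq_left this]

theorem IsProg.ite_mem_countable {ℱ : Filtration ℝ m} {M N : ℝ → Ω → ℝ≥0∞}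
    (hM : ∀ t, Measurable[ℱ t] (M t)) (hN : IsProg ℱ N) {D : Set ℝ} (hD : D.Countable)
    [DecidablePred (· ∈ D)] :
    IsProg ℱ fun t ω => if t ∈ D then M t ω else N t ω := by
  intro i
  let _ : MeasurableSpace Ω := ℱ i
  have hS : MeasurableSet {p : ℝ × Ω | min p.1 i ∈ D} :=
    (measurable_fst.min measurable_const) hD.measurableSet
  have := hD.to_subtype
  have h1 : Measurable fun q : D × Ω => M (min q.1 i) q.2 := by
    refine measurable_from_prod_countable_right fun j => ?_
    exact (hM (min j i)).mono (ℱ.mono (min_le_right _ _)) le_rfl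
  refine measurable_of_restrict_of_restrict_compl hS ?_ ?_
  · have h2 : Measurable fun p : {p : ℝ × Ω | min p.1 i ∈ D} =>
        ((⟨min p.1.1 i, p.2⟩ : D), p.1.2) :=
      (Measurable.subtype_mk (by fun_prop)).prodMk (by fun_prop)
    have e : ({p : ℝ × Ω | min p.1 i ∈ D}.domRestrict fun p : ℝ × Ω =>
        if min p.1 i ∈ D then M (min p.1 i) p.2 else N (min p.1 i) p.2) =
        (fun q : D × Ω => M (min q.1 i) q.2) ∘ fun p : {p : ℝ × Ω | min p.1 i ∈ D} =>
          ((⟨min p.1.1 i, p.2⟩ : D), p.1.2) := by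
      funext p
      have hp : min p.1.1 i ∈ D := p.2
      simp [Set.domRestrict, hp]
    rw [e]
    exact h1.comp h2
  · have e : ({p : ℝ × Ω | min p.1 i ∈ D}ᶜ.domRestrict fun p : ℝ × Ω =>
        if min p.1 i ∈ D then M (min p.1 i) p.2 else N (min p.1 i) p.2) =
        (fun p : ℝ × Ω => N (min p.1 i) p.2) ∘ Subtype.val := by
      funext p
      have hp : min p.1.1 i ∉ D := p.2
      simp [Set.domRestrict, hp]
    rw [e]
    exact (hN i).comp measurable_subtype_coe

theorem dyadicFloor_mono (t : ℝ) : Monotone fun n : ℕ => (⌊(2 : ℝ) ^ n * t⌋ : ℝ) / 2 ^ n := by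
  refine monotone_nat_of_le_succ fun n => ?_
  have h : (2 * ⌊(2 : ℝ) ^ n * t⌋ : ℤ) ≤ ⌊(2 : ℝ) ^ (n + 1) * t⌋ := by
    refine Int.le_floor.2 ?_
    push_cast
    have := Int.floor_le ((2 : ℝ) ^ n * t)
    rw [pow_succ]
    linarith
  have h' : (2 * ⌊(2 : ℝ) ^ n * t⌋ : ℝ) ≤ ⌊(2 : ℝ) ^ (n + 1) * t⌋ := by exact_mod_cast h
  rw [div_le_div_iff₀ (by positivity) (by positivity)]
  have := mul_le_mul_of_nonneg_right h' (pow_nonneg (zero_le_two (α := ℝ)) n)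
  linarith [pow_succ (2 : ℝ) n, mul_comm (2 : ℝ) ⌊(2 : ℝ) ^ n * t⌋,
    congrArg (fun x : ℝ => (⌊(2 : ℝ) ^ n * t⌋ : ℝ) * x) (pow_succ (2 : ℝ) n)]

theorem dyadicFloor_le (t : ℝ) (n : ℕ) : (⌊(2 : ℝ) ^ n * t⌋ : ℝ) / 2 ^ n ≤ t := by
  rw [div_le_iff₀ (by positivity), mul_comm t]
  exact Int.floor_le _

theorem tendsto_dyadicFloor (t : ℝ) :
    Tendsto (fun n : ℕ => (⌊(2 : ℝ) ^ n * t⌋ : ℝ) / 2 ^ n) atTop (nhds t) := by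
  refine tendsto_of_tendsto_of_tendsto_of_le_of_le (g := fun n : ℕ => t - (1 / 2) ^ n)
    ?_ tendsto_const_nhds (fun n => ?_) (dyadicFloor_le t)
  · simpa using tendsto_const_nhds.sub
      (tendsto_pow_atTop_nhds_zero_of_lt_one (r := (1 / 2 : ℝ)) (by norm_num) (by norm_num))
  · have h := Int.lt_floor_add_one ((2 : ℝ) ^ n * t)
    have h2 : (0 : ℝ) < 2 ^ n := by positivity
    dsimp only
    rw [le_div_iff₀ h2, sub_mul, one_div, inv_pow, inv_mul_cancel₀ h2.ne']
    linarith

/-- A bounded closed martingale admits a progressive modification. -/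
theorem exists_isProg_modification_condExp (P : Measure Ω) [IsProbabilityMeasure P]
    (ℱ : Filtration ℝ m) {X : Ω → ℝ} {k : NNReal} (hk : ∀ ω, |X ω| ≤ k) :
    ∃ N : ℝ → Ω → ℝ≥0∞, IsProg ℱ N ∧
      ∀ t, N t =ᵐ[P] fun ω => ENNReal.ofReal ((P[X|ℱ t]) ω) := by
  classical
  set q : ℝ → ℝ := fun t => ∫ ω, (P[X|ℱ t]) ω ^ 2 ∂P with hq
  have hqm : Monotone q := fun s t hst => by
    have h := integral_sq_condExp_sub P ℱ hk hst
    have h0 : 0 ≤ ∫ ω, ((P[X|ℱ t]) ω - (P[X|ℱ s]) ω) ^ 2 ∂P :=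
      integral_nonneg fun ω => sq_nonneg _
    simp only [hq]
    linarith
  set M : ℝ → Ω → ℝ≥0∞ := fun t ω => ENNReal.ofReal ((P[X|ℱ t]) ω) with hM
  have hMm (t : ℝ) : Measurable[ℱ t] (M t) := ENNReal.measurable_ofReal.comp
    (stronglyMeasurable_condExp (m := ℱ t) (μ := P)).measurable
  refine ⟨fun t ω => if t ∈ {t | ¬ ContinuousAt q t} then M t ω else
    limsup (fun n : ℕ => M (⌊(2 : ℝ) ^ n * t⌋ / 2 ^ n) ω) atTop,
    IsProg.ite_mem_countable hMm (IsProg.limsup fun n => IsProg.comp_floor hMm (by positivity))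
      hqm.countable_not_continuousAt, fun t => ?_⟩
  by_cases ht : t ∈ {t | ¬ ContinuousAt q t}
  · simp [ht, hM]
  simp only [ht, if_false]
  have hc : ContinuousAt q t := not_not.1 ht
  set d : ℕ → ℝ := fun n => (⌊(2 : ℝ) ^ n * t⌋ : ℝ) / 2 ^ n with hd
  let 𝒢 : Filtration ℕ m := ⟨fun n => ℱ (d n), fun i j hij => ℱ.mono (dyadicFloor_mono t hij),
    fun n => ℱ.le _⟩
  have hlevy : ∀ᵐ ω ∂P, Tendsto (fun n => (P[X|ℱ (d n)]) ω) atTop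
      (nhds ((P[X|⨆ n, 𝒢 n]) ω)) := tendsto_ae_condExp (ℱ := 𝒢) X
  have hb (r : MeasurableSpace Ω) : ∀ᵐ ω ∂P, ‖(P[X|r]) ω‖ ≤ k :=
    ae_bdd_abs_condExp_of_ae_bdd_abs (ae_of_all _ hk)
  have hmeas (r : MeasurableSpace Ω) : AEStronglyMeasurable[m] (P[X|r]) P := integrable_condExp.1
  have hlim : Tendsto (fun n => ∫ ω, ((P[X|ℱ t]) ω - (P[X|ℱ (d n)]) ω) ^ 2 ∂P) atTop
      (nhds (∫ ω, ((P[X|ℱ t]) ω - (P[X|⨆ n, 𝒢 n]) ω) ^ 2 ∂P)) := by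
    refine tendsto_integral_of_dominated_convergence (fun _ => (2 * k : ℝ) ^ 2)
      (fun n => ((hmeas _).sub (hmeas _)).pow 2) (integrable_const _) (fun n => ?_) ?_
    · filter_upwards [hb (ℱ t), hb (ℱ (d n))] with ω h1 h2
      rw [norm_pow]
      gcongr
      refine (norm_sub_le _ _).trans ?_
      linarith
    · filter_upwards [hlevy] with ω h
      exact (tendsto_const_nhds.sub h).pow 2
  have hlim0 : Tendsto (fun n => ∫ ω, ((P[X|ℱ t]) ω - (P[X|ℱ (d n)]) ω) ^ 2 ∂P) atTop
      (nhds 0) := by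
    have h1 : Tendsto (fun n => q t - q (d n)) atTop (nhds (q t - q t)) :=
      tendsto_const_nhds.sub (hc.tendsto.comp (tendsto_dyadicFloor t))
    rw [sub_self] at h1
    exact h1.congr fun n => (integral_sq_condExp_sub P ℱ hk (dyadicFloor_le t n)).symm
  have h0 := tendsto_nhds_unique hlim hlim0
  rw [integral_eq_zero_iff_of_nonneg (fun ω => sq_nonneg _)] at h0
  · filter_upwards [h0, hlevy] with ω h0 h
    have e : (P[X|ℱ t]) ω = (P[X|⨆ n, 𝒢 n]) ω := sub_eq_zero.1 (pow_eq_zero_iff two_ne_zero |>.1 h0)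
    rw [e]
    exact ((ENNReal.continuous_ofReal.tendsto _).comp h).limsup_eq
  · refine Integrable.of_bound (((hmeas _).sub (hmeas _)).pow 2) ((2 * k : ℝ) ^ 2) ?_
    filter_upwards [hb (ℱ t), hb (⨆ n, 𝒢 n)] with ω h1 h2
    rw [norm_pow]
    gcongr
    refine (norm_sub_le _ _).trans ?_
    linarith

theorem measurable_setLIntegral_left {f : ℝ → Ω → ℝ≥0∞}
    (hf : Measurable fun p : ℝ × Ω => f p.1 p.2) (S : Set ℝ) :
    Measurable fun ω => ∫⁻ s in S, f s ω :=
  hf.lintegral_prod_left'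

theorem lintegral_mul_setLIntegral_swap (P : Measure Ω) [SFinite P] {Z : Ω → ℝ≥0∞}
    (hZ : Measurable Z) {f : ℝ → Ω → ℝ≥0∞} (hf : Measurable fun p : ℝ × Ω => f p.1 p.2)
    (S : Set ℝ) :
    ∫⁻ ω, Z ω * (∫⁻ s in S, f s ω) ∂P = ∫⁻ s in S, ∫⁻ ω, Z ω * f s ω ∂P := by
  rw [lintegral_lintegral_swap (f := fun s ω => Z ω * f s ω)]
  · refine lintegral_congr fun ω => ?_
    rw [lintegral_const_mul]
    exact hf.comp (measurable_id.prodMk measurable_const)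
  · exact ((hZ.comp measurable_snd).mul hf).aemeasurable

theorem setLIntegral_Ioi_mul_tail {w c : ℝ → ℝ≥0∞} (hw : Measurable w) (hc : Measurable c)
    (t : ℝ) :
    ∫⁻ s in Ioi t, w s * ∫⁻ r in Ioi s, c r = ∫⁻ r in Ioi t, (∫⁻ s in Ioo t r, w s) * c r := by
  let F : ℝ → ℝ → ℝ≥0∞ := fun s r => if t < s ∧ s < r then w s * c r else 0
  have hF : Measurable (Function.uncurry F) := by
    refine Measurable.ite ?_ (by fun_prop) measurable_const
    exact (measurableSet_lt measurable_const measurable_fst).inter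
      (measurableSet_lt measurable_fst measurable_snd)
  have h1 : ∫⁻ s in Ioi t, w s * ∫⁻ r in Ioi s, c r = ∫⁻ s, ∫⁻ r, F s r := by
    rw [← lintegral_indicator measurableSet_Ioi]
    refine lintegral_congr fun s => ?_
    by_cases hs : t < s
    · rw [indicator_of_mem (show s ∈ Ioi t from hs), ← lintegral_const_mul _ hc,
        ← lintegral_indicator measurableSet_Ioi]
      refine lintegral_congr fun r => ?_
      by_cases hr : s < r <;> simp [F, hs, hr]
    · simp [F, hs]
  have h2 : ∫⁻ r in Ioi t, (∫⁻ s in Ioo t r, w s) * c r = ∫⁻ r, ∫⁻ s, F s r := by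
    rw [← lintegral_indicator measurableSet_Ioi]
    refine lintegral_congr fun r => ?_
    by_cases hr : t < r
    · rw [indicator_of_mem (show r ∈ Ioi t from hr), ← lintegral_mul_const _ hw,
        ← lintegral_indicator measurableSet_Ioo]
      refine lintegral_congr fun s => ?_
      by_cases hs : t < s ∧ s < r
      · rw [indicator_of_mem (show s ∈ Ioo t r from hs)]; simp [F, hs]
      · rw [indicator_of_notMem (show s ∉ Ioo t r from hs)]; simp only [F, hs, if_false]
    · rw [indicator_of_notMem (show r ∉ Ioi t from hr)]
      have (s : ℝ) : F s r = 0 := if_neg fun h => hr (h.1.trans h.2)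
      simp [this]
  rw [h1, h2, lintegral_lintegral_swap hF.aemeasurable]

/-- `V` is a progressive version of the process `t ↦ E[∫_t^∞ a_s ds | ℱ_t]`, `t ≥ 0`. -/
structure IsProj (P : Measure Ω) (ℱ : Filtration ℝ m) (a V : ℝ → Ω → ℝ≥0∞) : Prop where
  isProg : IsProg ℱ V
  ae_eq : ∀ t, 0 ≤ t → V t =ᵐ[P] P⁻[fun ω => ∫⁻ s in Ioi t, a s ω | ℱ t]

namespace IsProj

variable {P : Measure Ω} [IsProbabilityMeasure P] {ℱ : Filtration ℝ m} {a V : ℝ → Ω → ℝ≥0∞}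

theorem lintegral_mul (hV : IsProj P ℱ a V) (ha : IsProg ℱ a) {t : ℝ} (ht : 0 ≤ t)
    {Z : Ω → ℝ≥0∞} (hZ : Measurable[ℱ t] Z) :
    ∫⁻ ω, Z ω * V t ω ∂P = ∫⁻ ω, Z ω * (∫⁻ s in Ioi t, a s ω) ∂P := by
  rw [← lintegral_mul_condLExp P (ℱ.le t)
    (measurable_setLIntegral_left ha.measurable_uncurry _) hZ]
  refine lintegral_congr_ae ?_
  filter_upwards [hV.ae_eq t ht] with ω h
  rw [h]

theorem of_setLIntegral (hV : IsProg ℱ V)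
    (h : ∀ t, 0 ≤ t → ∀ Z : Ω → ℝ≥0∞, Measurable[ℱ t] Z → (∀ ω, Z ω ≤ 1) →
      ∫⁻ ω, Z ω * V t ω ∂P = ∫⁻ ω, Z ω * (∫⁻ s in Ioi t, a s ω) ∂P) :
    IsProj P ℱ a V := by
  refine ⟨hV, fun t ht => ae_eq_condLExp (ℱ.le t) P _ (hV.measurable_apply t) fun s hs => ?_⟩
  have key (Y : Ω → ℝ≥0∞) : ∫⁻ ω, s.indicator (fun _ => 1) ω * Y ω ∂P = ∫⁻ ω in s, Y ω ∂P := by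
    rw [← lintegral_indicator (ℱ.le t s hs)]
    refine lintegral_congr fun ω => ?_
    by_cases hω : ω ∈ s <;> simp [hω]
  rw [← key, ← key]
  exact h t ht _ (measurable_const.indicator hs) fun ω => indicator_le_self' (by simp) ω

theorem ae_lt_top (hV : IsProj P ℱ a V) (ha : IsProg ℱ a)
    (hfin : ∫⁻ ω, (∫⁻ s in Ioi 0, a s ω) ∂P < ∞) {t : ℝ} (ht : 0 ≤ t) :
    ∀ᵐ ω ∂P, V t ω < ∞ := by
  refine MeasureTheory.ae_lt_top (hV.isProg.measurable_apply' t) ?_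
  have h := hV.lintegral_mul ha ht (Z := fun _ => 1) measurable_const
  simp only [one_mul] at h
  rw [h]
  exact (lt_of_le_of_lt (lintegral_mono fun ω => lintegral_mono_set (Ioi_subset_Ioi ht)) hfin).ne

/-- Tonelli's theorem against a projected process. -/
theorem lintegral_mul_Ioi_mul (hV : IsProj P ℱ a V) (ha : IsProg ℱ a) {w : ℝ → Ω → ℝ≥0∞}
    (hw : IsProg ℱ w) {t : ℝ} (ht : 0 ≤ t) {Z : Ω → ℝ≥0∞} (hZ : Measurable[ℱ t] Z) :
    ∫⁻ ω, Z ω * (∫⁻ s in Ioi t, w s ω * V s ω) ∂P =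
      ∫⁻ ω, Z ω * (∫⁻ r in Ioi t, (∫⁻ s in Ioo t r, w s ω) * a r ω) ∂P := by
  have hZ' : Measurable Z := hZ.mono (ℱ.le t) le_rfl
  have hA : Measurable fun p : ℝ × Ω => ∫⁻ r in Ioi p.1, a r p.2 := by
    have h : Measurable fun q : (ℝ × Ω) × ℝ => if q.1.1 < q.2 then a q.2 q.1.2 else 0 := by
      refine Measurable.ite (measurableSet_lt (by fun_prop) (by fun_prop)) ?_ measurable_const
      exact ha.measurable_uncurry.comp (g := fun p : ℝ × Ω => a p.1 p.2)
        (f := fun q : (ℝ × Ω) × ℝ => (q.2, q.1.2)) (by fun_prop)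
    convert h.lintegral_prod_right' (ν := volume) using 2 with p
    rw [← lintegral_indicator measurableSet_Ioi]
    refine lintegral_congr fun r => ?_
    by_cases hr : p.1 < r <;> simp [hr]
  rw [lintegral_mul_setLIntegral_swap P hZ' (hw.mul hV.isProg).measurable_uncurry]
  have h1 : ∫⁻ s in Ioi t, ∫⁻ ω, Z ω * (w s ω * V s ω) ∂P =
      ∫⁻ s in Ioi t, ∫⁻ ω, Z ω * (w s ω * ∫⁻ r in Ioi s, a r ω) ∂P := by
    refine setLIntegral_congr_fun measurableSet_Ioi fun s (hs : t < s) => ?_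
    simp only [← mul_assoc]
    exact hV.lintegral_mul ha (ht.trans hs.le) (Z := fun ω => Z ω * w s ω)
      ((hZ.mono (ℱ.mono hs.le) le_rfl).mul (hw.measurable_apply s))
  rw [h1, ← lintegral_mul_setLIntegral_swap P hZ'
    (f := fun s ω => w s ω * ∫⁻ r in Ioi s, a r ω) (hw.measurable_uncurry.mul hA)]
  refine lintegral_congr fun ω => ?_
  rw [setLIntegral_Ioi_mul_tail (hw.measurable_path ω) (ha.measurable_path ω)]

/-- The projection of `a` solves the backward equation obtained by discounting at rate `μ`. -/
theorem lintegral_mul_discount (hV : IsProj P ℱ a V) (ha : IsProg ℱ a) {μ D : ℝ → Ω → ℝ≥0∞}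
    (hμ : IsProg ℱ μ) (hD : IsProg ℱ D) {t : ℝ} (ht : 0 ≤ t)
    (hDμ : ∀ ω r, t < r → D r ω + ∫⁻ s in Ioo t r, D s ω * μ s ω = 1)
    {Z : Ω → ℝ≥0∞} (hZ : Measurable[ℱ t] Z) :
    ∫⁻ ω, Z ω * V t ω ∂P =
      ∫⁻ ω, Z ω * (∫⁻ s in Ioi t, D s ω * (a s ω + μ s ω * V s ω)) ∂P := by
  have hZ' : Measurable Z := hZ.mono (ℱ.le t) le_rfl
  have h := hV.lintegral_mul_Ioi_mul ha (hD.mul hμ) ht hZ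
  have hm1 : Measurable fun ω => ∫⁻ s in Ioi t, D s ω * a s ω :=
    measurable_setLIntegral_left (hD.mul ha).measurable_uncurry _
  have e1 (ω : Ω) : Z ω * ∫⁻ s in Ioi t, D s ω * (a s ω + μ s ω * V s ω) =
      Z ω * (∫⁻ s in Ioi t, D s ω * a s ω) +
        Z ω * ∫⁻ s in Ioi t, D s ω * μ s ω * V s ω := by
    rw [← mul_add, ← lintegral_add_left ((hD.mul ha).measurable_path ω)]
    simp only [mul_add, mul_assoc]
  have e2 (ω : Ω) : Z ω * ∫⁻ s in Ioi t, a s ω =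
      Z ω * (∫⁻ s in Ioi t, D s ω * a s ω) +
        Z ω * ∫⁻ r in Ioi t, (∫⁻ s in Ioo t r, D s ω * μ s ω) * a r ω := by
    rw [← mul_add, ← lintegral_add_left ((hD.mul ha).measurable_path ω)]
    congr 1
    refine setLIntegral_congr_fun measurableSet_Ioi fun r hr => ?_
    rw [← add_mul, hDμ ω r hr, one_mul]
  simp_rw [e1]
  have hm2 : Measurable fun ω => Z ω * ∫⁻ s in Ioi t, D s ω * a s ω := hZ'.mul hm1
  rw [hV.lintegral_mul ha ht hZ, lintegral_add_left hm2, h]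
  simp_rw [e2]
  rw [lintegral_add_left hm2]

end IsProj

theorem exists_isProj {P : Measure Ω} [IsProbabilityMeasure P] {ℱ : Filtration ℝ m}
    {a : ℝ → Ω → ℝ≥0∞} (ha : IsProg ℱ a) (hfin : ∫⁻ ω, (∫⁻ s in Ioi 0, a s ω) ∂P < ∞) :
    ∃ V, IsProj P ℱ a V := by
  set X : Ω → ℝ≥0∞ := fun ω => ∫⁻ s in Ioi 0, a s ω with hX
  have hXm : Measurable X := measurable_setLIntegral_left ha.measurable_uncurry _
  have hbd (k : ℕ) (ω : Ω) : |(min (X ω) (k : ℝ≥0∞)).toReal| ≤ (k : NNReal) := by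
    rw [abs_of_nonneg ENNReal.toReal_nonneg]
    exact ENNReal.toReal_le_of_le_ofReal (by positivity) (by simp)
  choose N hN hNae using fun k : ℕ => exists_isProg_modification_condExp P ℱ (hbd k)
  refine ⟨fun t ω => (⨆ k, N k t ω) - ∫⁻ s in Ioc 0 t, a s ω,
    (IsProg.iSup hN).sub (ha.lintegral_Ioc 0), fun t ht => ?_⟩
  have hJ : Measurable[ℱ t] fun ω => ∫⁻ s in Ioc 0 t, a s ω :=
    (ha.lintegral_Ioc 0).measurable_apply t
  have hJ' : Measurable fun ω => ∫⁻ s in Ioc 0 t, a s ω := hJ.mono (ℱ.le t) le_rfl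
  have hsplit (ω : Ω) : X ω = (∫⁻ s in Ioc 0 t, a s ω) + ∫⁻ s in Ioi t, a s ω := by
    rw [hX, ← lintegral_union measurableSet_Ioi, Ioc_union_Ioi_eq_Ioi ht]
    exact Set.disjoint_left.2 fun x hx hx' => not_lt.2 hx.2 hx'
  have h1 : condExpENN P (ℱ t) X =ᵐ[P] P⁻[X|ℱ t] := condExpENN_ae_eq_condLExp P (ℱ.le t) hXm
  have h2 : (fun ω => (∫⁻ s in Ioc 0 t, a s ω) + (P⁻[fun ω => ∫⁻ s in Ioi t, a s ω | ℱ t]) ω)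
      =ᵐ[P] P⁻[X|ℱ t] := by
    refine ae_eq_condLExp (ℱ.le t) P X (hJ.add (measurable_condLExp _ _ _)) fun s hs => ?_
    rw [lintegral_add_left hJ', setLIntegral_condLExp (ℱ.le t) P _ hs, ← lintegral_add_left hJ']
    simp_rw [hsplit]
  have h3 : ∀ᵐ ω ∂P, X ω < ∞ := ae_lt_top hXm hfin.ne
  filter_upwards [h1, h2, h3, ae_all_iff.2 fun k => hNae k t] with ω h1 h2 h3 h4
  have e : ⨆ k, N k t ω = condExpENN P (ℱ t) X ω := by
    simp only [condExpENN, h4]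
  rw [e, h1, ← h2, ENNReal.add_sub_cancel_left]
  exact (lt_of_le_of_lt (le_self_add.trans (hsplit ω).ge) h3).ne

/-- The discount factor `exp (-∫_t^s μ)`. -/
def discount (μ : ℝ → ℝ≥0∞) (t s : ℝ) : ℝ≥0∞ :=
  ENNReal.ofReal (Real.exp (-(∫⁻ r in Ioc t s, μ r).toReal))

theorem discount_le_one (μ : ℝ → ℝ≥0∞) (t s : ℝ) : discount μ t s ≤ 1 := by
  rw [discount, ← ENNReal.ofReal_one]
  refine ENNReal.ofReal_le_ofReal (Real.exp_le_one_iff.2 ?_)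
  simp

theorem discount_const (L : NNReal) {t s : ℝ} (hts : t ≤ s) :
    discount (fun _ => (L : ℝ≥0∞)) t s = ENNReal.ofReal (Real.exp (-(L * (s - t)))) := by
  simp [discount, ENNReal.toReal_mul, ENNReal.toReal_ofReal (sub_nonneg.2 hts)]

theorem lipschitzOnWith_exp_neg :
    LipschitzOnWith 1 (fun x : ℝ => Real.exp (-x)) (Ici 0) := by
  refine (convex_Ici 0).lipschitzOnWith_of_nnnorm_deriv_le (fun x _ => by fun_prop) fun x hx => ?_
  have : deriv (fun x : ℝ => Real.exp (-x)) x = -Real.exp (-x) := by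
    simpa using ((hasDerivAt_neg x).exp).deriv
  rw [this, nnnorm_neg, ← NNReal.coe_le_coe, coe_nnnorm, Real.norm_of_nonneg (Real.exp_pos _).le]
  exact Real.exp_le_one_iff.2 (neg_nonpos.2 hx)

/-- The fundamental theorem of calculus for the discount factor of a bounded rate. -/
theorem discount_add_setLIntegral {μ : ℝ → ℝ≥0∞} (hμ : Measurable μ) {N : NNReal}
    (hN : ∀ s, μ s ≤ N) {t r : ℝ} (htr : t < r) :
    discount μ t r + ∫⁻ s in Ioo t r, discount μ t s * μ s = 1 := by
  set g : ℝ → ℝ := fun s => (μ s).toReal with hg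
  have hg0 (s : ℝ) : 0 ≤ g s := ENNReal.toReal_nonneg
  have hfin (s : ℝ) : μ s ≠ ∞ := ne_top_of_le_ne_top ENNReal.coe_ne_top (hN s)
  have hgN (s : ℝ) : ‖g s‖ ≤ N := by
    rw [Real.norm_of_nonneg (hg0 s)]
    exact ENNReal.toReal_le_coe_of_le_coe (hN s)
  have hgm : Measurable g := hμ.ennreal_toReal
  have hgi (x y : ℝ) : IntervalIntegrable g volume x y := by
    have : IsFiniteMeasure (volume.restrict (uIoc x y)) := ⟨by simp [uIoc]⟩
    refine intervalIntegrable_iff.2 (Integrable.of_bound hgm.aestronglyMeasurable (N : ℝ)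
      (ae_of_all _ hgN))
  set G : ℝ → ℝ := fun x => ∫ s in t..x, g s with hG
  have hG0 {x : ℝ} (hx : t ≤ x) : 0 ≤ G x := intervalIntegral.integral_nonneg hx fun s _ => hg0 s
  have hGe {x : ℝ} (hx : t ≤ x) : discount μ t x = ENNReal.ofReal (Real.exp (-G x)) := by
    rw [discount, hG]
    dsimp only
    rw [intervalIntegral.integral_of_le hx, hg, integral_toReal hμ.aemeasurable
      (ae_of_all _ fun s => (hfin s).lt_top)]
  have hGlip : LipschitzOnWith N G (uIcc t r) := by
    refine LipschitzOnWith.of_dist_le_mul fun x _ y _ => ?_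
    rw [Real.dist_eq, Real.dist_eq, hG]
    dsimp only
    rw [intervalIntegral.integral_interval_sub_left (hgi _ _) (hgi _ _), ← Real.norm_eq_abs]
    exact intervalIntegral.norm_integral_le_of_norm_le_const fun s _ => hgN s
  have hFac : AbsolutelyContinuousOnInterval (fun x => Real.exp (-G x)) t r := by
    refine LipschitzOnWith.absolutelyContinuousOnInterval
      (lipschitzOnWith_exp_neg.comp hGlip fun x hx => ?_)
    rw [uIcc_of_le htr.le] at hx
    exact hG0 hx.1
  have hFTC := hFac.integral_deriv_eq_sub
  have hderiv : ∀ᵐ x, x ∈ Ioc t r → deriv (fun x => Real.exp (-G x)) x =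
      -(Real.exp (-G x) * g x) := by
    filter_upwards [(hgi t r).ae_hasDerivAt_integral] with x hx hxm
    have h := hx (by rw [uIcc_of_le htr.le]; exact Ioc_subset_Icc_self hxm) t left_mem_uIcc
    simpa using h.neg.exp.deriv
  have hGc : Continuous G := intervalIntegral.continuous_primitive hgi t
  have hint : IntegrableOn (fun x => Real.exp (-G x) * g x) (Ioc t r) := by
    refine Integrable.of_bound (by fun_prop) (N : ℝ) ?_
    filter_upwards [ae_restrict_mem measurableSet_Ioc] with x hx
    rw [norm_mul, Real.norm_of_nonneg (Real.exp_pos _).le, ← one_mul (N : ℝ)]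
    have := hG0 hx.1.le
    exact mul_le_mul (Real.exp_le_one_iff.2 (by linarith)) (hgN x) (norm_nonneg _) zero_le_one
  have hval : ∫ x in Ioc t r, Real.exp (-G x) * g x = 1 - Real.exp (-G r) := by
    have hGt : G t = 0 := intervalIntegral.integral_same
    rw [intervalIntegral.integral_of_le htr.le, setIntegral_congr_ae measurableSet_Ioc hderiv,
      integral_neg, hGt, neg_zero, Real.exp_zero] at hFTC
    linarith
  have hlin : ∫⁻ s in Ioo t r, discount μ t s * μ s = ENNReal.ofReal (1 - Real.exp (-G r)) := by
    rw [← hval, ofReal_integral_eq_lintegral_ofReal hint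
      (ae_of_all _ fun x => mul_nonneg (Real.exp_pos _).le (hg0 x)), ← restrict_Ioo_eq_restrict_Ioc]
    refine setLIntegral_congr_fun measurableSet_Ioo fun s hs => ?_
    rw [hGe hs.1.le, ENNReal.ofReal_mul (Real.exp_pos _).le, hg, ENNReal.ofReal_toReal (hfin s)]
  have hG1 : Real.exp (-G r) ≤ 1 := Real.exp_le_one_iff.2 (by linarith [hG0 htr.le])
  rw [hlin, hGe htr.le, ← ENNReal.ofReal_add (Real.exp_pos _).le (by linarith)]
  simp

theorem IsProg.discount {ℱ : Filtration ℝ m} {μ : ℝ → Ω → ℝ≥0∞} (hμ : IsProg ℱ μ) (t : ℝ) :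
    IsProg ℱ fun s ω => discount (fun r => μ r ω) t s :=
  (hμ.lintegral_Ioc t).comp (g := fun x => ENNReal.ofReal (Real.exp (-x.toReal))) (by fun_prop)

theorem lintegral_mul_tail_mono {P : Measure Ω} [SFinite P] {Z : Ω → ℝ≥0∞}
    (hZ : Measurable Z) {f g : ℝ → Ω → ℝ≥0∞} (hf : Measurable fun p : ℝ × Ω => f p.1 p.2)
    (hg : Measurable fun p : ℝ × Ω => g p.1 p.2) {t : ℝ}
    (h : ∀ᵐ s ∂volume.restrict (Ioi t), ∀ᵐ ω ∂P, f s ω ≤ g s ω) :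
    ∫⁻ ω, Z ω * (∫⁻ s in Ioi t, f s ω) ∂P ≤ ∫⁻ ω, Z ω * (∫⁻ s in Ioi t, g s ω) ∂P := by
  rw [lintegral_mul_setLIntegral_swap P hZ hf, lintegral_mul_setLIntegral_swap P hZ hg]
  refine lintegral_mono_ae ?_
  filter_upwards [h] with s hs
  refine lintegral_mono_ae ?_
  filter_upwards [hs] with ω hω
  gcongr

theorem ae_le_of_lintegral_mul_le {P : Measure Ω} {mm : MeasurableSpace Ω} (hm : mm ≤ m)
    {f g : Ω → ℝ≥0∞} (hf : Measurable[mm] f) (hg : Measurable[mm] g)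
    (hfin : ∫⁻ ω, g ω ∂P ≠ ∞)
    (h : ∀ Z : Ω → ℝ≥0∞, Measurable[mm] Z → (∀ ω, Z ω ≤ 1) →
      ∫⁻ ω, Z ω * f ω ∂P ≤ ∫⁻ ω, Z ω * g ω ∂P) :
    ∀ᵐ ω ∂P, f ω ≤ g ω := by
  set S : Set Ω := {ω | g ω < f ω} with hS
  have hSm : MeasurableSet[mm] S := measurableSet_lt hg hf
  set Z : Ω → ℝ≥0∞ := S.indicator fun _ => 1 with hZdef
  have hZ : Measurable[mm] Z := (@measurable_const _ _ _ mm _).indicator hSm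
  have hZ1 (ω : Ω) : Z ω ≤ 1 := indicator_le_self' (by simp) ω
  have hle : (fun ω => Z ω * g ω) ≤ᵐ[P] fun ω => Z ω * f ω := ae_of_all _ fun ω => by
    by_cases hω : ω ∈ S
    · exact mul_le_mul_right (le_of_lt hω) _
    · simp [hZdef, hω]
  have hfin' : ∫⁻ ω, Z ω * g ω ∂P ≠ ∞ :=
    ne_top_of_le_ne_top hfin (lintegral_mono fun ω => mul_le_of_le_one_left' (hZ1 ω))
  have heq := ae_eq_of_ae_le_of_lintegral_le hle hfin'
    ((hZ.mul hf).mono hm le_rfl).aemeasurable (h Z hZ hZ1)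
  filter_upwards [heq] with ω hω
  by_contra! hlt
  have : Z ω = 1 := indicator_of_mem (show ω ∈ S from hlt) _
  simp only [this, one_mul] at hω
  exact hlt.ne hω

/-- Linearization of a decreasing driver, with slope truncated at `N`. -/
theorem add_min_div_mul_le {b b' w w' N : ℝ≥0∞} (hw : w ≠ ∞) (h1 : w ≤ w' → b' ≤ b)
    (h2 : w' ≤ w → b ≤ b') :
    b' + min (((b - b') + (b' - b)) / ((w - w') + (w' - w))) N * w' ≤
      b + min (((b - b') + (b' - b)) / ((w - w') + (w' - w))) N * w +
        (((b - b') + (b' - b)) - N * ((w - w') + (w' - w))) := by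
  rcases le_total w w' with hle | hle
  · rw [tsub_eq_zero_of_le (h1 hle), tsub_eq_zero_of_le hle, add_zero, zero_add]
    refine le_add_right ?_
    set μ := min ((b - b') / (w' - w)) N
    have e : μ * (w' - w) ≤ b - b' :=
      (mul_le_mul_left (min_le_left _ _) _).trans ((mul_comm _ _).trans_le ENNReal.mul_div_le)
    calc b' + μ * w' = b' + μ * ((w' - w) + w) := by rw [tsub_add_cancel_of_le hle]
      _ = b' + (μ * (w' - w)) + μ * w := by ring
      _ ≤ b' + (b - b') + μ * w := by gcongr
      _ = b + μ * w := by rw [add_tsub_cancel_of_le (h1 hle)]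
  · rw [tsub_eq_zero_of_le (h2 hle), tsub_eq_zero_of_le hle, add_zero, zero_add]
    set μ := min ((b' - b) / (w - w')) N with hμ
    have e : b' - b ≤ μ * (w - w') + ((b' - b) - N * (w - w')) := by
      rcases le_total ((b' - b) / (w - w')) N with hc | hc
      · refine le_add_right ?_
        rw [hμ, min_eq_left hc]
        rcases eq_or_ne (w - w') 0 with h0 | h0
        · have := h1 (tsub_eq_zero_iff_le.1 h0)
          simp [tsub_eq_zero_of_le this]
        · rw [ENNReal.div_mul_cancel h0 (ne_top_of_le_ne_top hw tsub_le_self)]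
      · rw [hμ, min_eq_right hc]
        exact le_add_tsub
    calc b' + μ * w' = b + (b' - b) + μ * w' := by rw [add_tsub_cancel_of_le (h2 hle)]
      _ ≤ b + (μ * (w - w') + ((b' - b) - N * (w - w'))) + μ * w' := by gcongr
      _ = b + μ * ((w - w') + w') + ((b' - b) - N * (w - w')) := by ring
      _ = _ := by rw [tsub_add_cancel_of_le hle]

/-- Comparison principle for projected processes with a decreasing driver. -/
theorem IsProj.comparison {P : Measure Ω} [IsProbabilityMeasure P] {ℱ : Filtration ℝ m}
    {b b' p p' W W' : ℝ → Ω → ℝ≥0∞} (hb : IsProg ℱ b) (hb' : IsProg ℱ b') (hp : IsProg ℱ p)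
    (hp' : IsProg ℱ p')
    (hW : IsProj P ℱ (fun s ω => b s ω + p s ω) W)
    (hW' : IsProj P ℱ (fun s ω => b' s ω + p' s ω) W')
    (hfin : ∫⁻ ω, (∫⁻ s in Ioi 0, b s ω + p s ω) ∂P < ∞)
    (hfin' : ∫⁻ ω, (∫⁻ s in Ioi 0, b' s ω + p' s ω) ∂P < ∞)
    (h1 : ∀ s ω, W s ω ≤ W' s ω → b' s ω ≤ b s ω) (h2 : ∀ s ω, W' s ω ≤ W s ω → b s ω ≤ b' s ω)
    (hpp : ∀ s ω, p' s ω ≤ p s ω) {t : ℝ} (ht : 0 ≤ t) :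
    ∀ᵐ ω ∂P, W' t ω ≤ W t ω := by
  have ha := hb.add hp
  have ha' := hb'.add hp'
  set β : ℝ → Ω → ℝ≥0∞ := fun s ω => (b s ω - b' s ω) + (b' s ω - b s ω) with hβ
  set d : ℝ → Ω → ℝ≥0∞ := fun s ω => (W s ω - W' s ω) + (W' s ω - W s ω) with hd
  have hβp : IsProg ℱ β := (hb.sub hb').add (hb'.sub hb)
  have hdp : IsProg ℱ d := (hW.isProg.sub hW'.isProg).add (hW'.isProg.sub hW.isProg)
  set μ : ℕ → ℝ → Ω → ℝ≥0∞ := fun N s ω => min (β s ω / d s ω) N with hμ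
  set η : ℕ → ℝ → Ω → ℝ≥0∞ := fun N s ω => β s ω - N * d s ω with hη
  have hμp (N : ℕ) : IsProg ℱ (μ N) := (hβp.div hdp).comp (g := fun x => min x N) (by fun_prop)
  have hηp (N : ℕ) : IsProg ℱ (η N) :=
    hβp.sub (hdp.comp (g := fun x => (N : ℝ≥0∞) * x) (by fun_prop))
  have hβfin : ∫⁻ ω, (∫⁻ s in Ioi t, β s ω) ∂P < ∞ := by
    refine lt_of_le_of_lt ?_ (ENNReal.add_lt_top.2 ⟨hfin, hfin'⟩)
    rw [← lintegral_add_left (measurable_setLIntegral_left ha.measurable_uncurry _)]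
    refine lintegral_mono fun ω => (lintegral_mono_set (Ioi_subset_Ioi ht)).trans ?_
    rw [← lintegral_add_left (ha.measurable_path ω)]
    refine lintegral_mono fun s => add_le_add ?_ ?_
    · exact tsub_le_self.trans le_self_add
    · exact tsub_le_self.trans le_self_add
  have hlim : Tendsto (fun N => ∫⁻ ω, (∫⁻ s in Ioi t, η N s ω) ∂P) atTop (nhds 0) := by
    have hη0 : Tendsto (fun N => ∫⁻ q, η N q.2 q.1 ∂P.prod (volume.restrict (Ioi t))) atTop
        (nhds (∫⁻ _, 0 ∂P.prod (volume.restrict (Ioi t)))) := by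
      have hβm : Measurable fun q : Ω × ℝ => β q.2 q.1 :=
        hβp.measurable_uncurry.comp measurable_swap
      have hβe : ∫⁻ q, β q.2 q.1 ∂P.prod (volume.restrict (Ioi t)) ≠ ∞ := by
        rw [lintegral_prod _ hβm.aemeasurable]
        exact hβfin.ne
      refine tendsto_lintegral_of_dominated_convergence (fun q => β q.2 q.1)
        (fun N => (hηp N).measurable_uncurry.comp measurable_swap)
        (fun N => ae_of_all _ fun q => tsub_le_self) hβe ?_
      filter_upwards [MeasureTheory.ae_lt_top hβm hβe] with q hq
      rcases eq_or_ne (d q.2 q.1) 0 with h0 | h0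
      · have h0' : W q.2 q.1 - W' q.2 q.1 = 0 ∧ W' q.2 q.1 - W q.2 q.1 = 0 := by
          simpa [hd] using h0
        have hβ0 : β q.2 q.1 = 0 := by
          have e1 := h1 q.2 q.1 (tsub_eq_zero_iff_le.1 h0'.1)
          have e2 := h2 q.2 q.1 (tsub_eq_zero_iff_le.1 h0'.2)
          simp [hβ, tsub_eq_zero_of_le e1, tsub_eq_zero_of_le e2]
        simp [hη, hβ0]
      · have : Tendsto (fun N : ℕ => (N : ℝ≥0∞) * d q.2 q.1) atTop (nhds (∞ * d q.2 q.1)) :=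
          ENNReal.Tendsto.mul_const ENNReal.tendsto_nat_nhds_top (Or.inl ENNReal.top_ne_zero)
        rw [ENNReal.top_mul h0] at this
        refine tendsto_const_nhds.congr' ?_
        filter_upwards [this.eventually (lt_mem_nhds hq)] with N hN
        exact (tsub_eq_zero_of_le hN.le).symm
    rw [lintegral_zero] at hη0
    refine hη0.congr fun N => ?_
    rw [lintegral_prod (fun q : Ω × ℝ => η N q.2 q.1)
      ((hηp N).measurable_uncurry.comp measurable_swap).aemeasurable]
  have hWfin : ∫⁻ ω, W t ω ∂P ≠ ∞ := by
    have h := hW.lintegral_mul ha ht (Z := fun _ => 1) measurable_const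
    simp only [one_mul] at h
    rw [h]
    exact (lt_of_le_of_lt
      (lintegral_mono fun ω => lintegral_mono_set (Ioi_subset_Ioi ht)) hfin).ne
  refine ae_le_of_lintegral_mul_le (ℱ.le t) (hW'.isProg.measurable_apply t)
    (hW.isProg.measurable_apply t) hWfin fun Z hZ hZ1 => ?_
  have hZ' : Measurable Z := hZ.mono (ℱ.le t) le_rfl
  have key (N : ℕ) : ∫⁻ ω, Z ω * W' t ω ∂P ≤
      ∫⁻ ω, Z ω * W t ω ∂P + ∫⁻ ω, (∫⁻ s in Ioi t, η N s ω) ∂P := by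
    set D : ℝ → Ω → ℝ≥0∞ := fun s ω => discount (fun r => μ N r ω) t s with hD
    have hDp : IsProg ℱ D := (hμp N).discount t
    have hDμ (ω : Ω) (r : ℝ) (hr : t < r) :
        D r ω + ∫⁻ s in Ioo t r, D s ω * μ N s ω = 1 :=
      discount_add_setLIntegral (N := (N : NNReal)) ((hμp N).measurable_path ω)
        (fun s => by simp [hμ]) hr
    have hX : IsProg ℱ fun s ω => D s ω * (b s ω + p s ω + μ N s ω * W s ω) :=
      hDp.mul (ha.add ((hμp N).mul hW.isProg))
    have hX' : IsProg ℱ fun s ω => D s ω * (b' s ω + p' s ω + μ N s ω * W' s ω) :=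
      hDp.mul (ha'.add ((hμp N).mul hW'.isProg))
    rw [hW.lintegral_mul_discount ha (hμp N) hDp ht hDμ hZ,
      hW'.lintegral_mul_discount ha' (hμp N) hDp ht hDμ hZ]
    calc _ ≤ ∫⁻ ω, Z ω * (∫⁻ s in Ioi t,
          (D s ω * (b s ω + p s ω + μ N s ω * W s ω) + η N s ω)) ∂P := by
          refine lintegral_mul_tail_mono hZ' hX'.measurable_uncurry
            (hX.add (hηp N)).measurable_uncurry ?_
          filter_upwards [ae_restrict_mem measurableSet_Ioi] with s (hs : t < s)
          filter_upwards [hW.ae_lt_top ha hfin (ht.trans hs.le)] with ω hω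
          have hlin := add_min_div_mul_le (N := N) hω.ne (h1 s ω) (h2 s ω)
          calc D s ω * (b' s ω + p' s ω + μ N s ω * W' s ω)
              = D s ω * ((b' s ω + μ N s ω * W' s ω) + p' s ω) := by ring
            _ ≤ D s ω * ((b s ω + μ N s ω * W s ω + η N s ω) + p s ω) := by
              gcongr
              exact hpp s ω
            _ = D s ω * (b s ω + p s ω + μ N s ω * W s ω) + D s ω * η N s ω := by ring
            _ ≤ _ := by
              gcongr
              exact mul_le_of_le_one_left' (discount_le_one _ _ _)
      _ ≤ ∫⁻ ω, (Z ω * (∫⁻ s in Ioi t, D s ω * (b s ω + p s ω + μ N s ω * W s ω))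
          + ∫⁻ s in Ioi t, η N s ω) ∂P := by
          refine lintegral_mono fun ω => ?_
          rw [lintegral_add_left (hX.measurable_path ω), mul_add]
          gcongr
          exact mul_le_of_le_one_left' (hZ1 ω)
      _ = _ := by
          rw [lintegral_add_right _ (measurable_setLIntegral_left (hηp N).measurable_uncurry _)]
  have := ge_of_tendsto' (tendsto_const_nhds.add hlim) key
  simpa using this

/-- The exponential `s ↦ exp (c * s)` as a `[0,∞]`-valued function. -/
def expWeight (c s : ℝ) : ℝ≥0∞ := ENNReal.ofReal (Real.exp (c * s))

@[fun_prop]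
theorem measurable_expWeight (c : ℝ) : Measurable (expWeight c) := by
  unfold expWeight
  fun_prop

theorem expWeight_pos (c s : ℝ) : expWeight c s ≠ 0 := by
  simp [expWeight, Real.exp_pos]

theorem expWeight_ne_top (c s : ℝ) : expWeight c s ≠ ∞ := ENNReal.ofReal_ne_top

theorem expWeight_mul_expWeight_neg (c s : ℝ) : expWeight c s * expWeight (-c) s = 1 := by
  rw [expWeight, expWeight, ← ENNReal.ofReal_mul (Real.exp_pos _).le, ← Real.exp_add]
  simp

theorem expWeight_neg_mul_discount (L : NNReal) {t s : ℝ} (hts : t ≤ s) :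
    expWeight (-L) t * discount (fun _ => (L : ℝ≥0∞)) t s = expWeight (-L) s := by
  rw [discount_const L hts, expWeight, expWeight, ← ENNReal.ofReal_mul (Real.exp_pos _).le,
    ← Real.exp_add]
  congr 2
  ring

theorem setLIntegral_mul_expWeight (L : NNReal) {t r : ℝ} (htr : t < r) :
    (∫⁻ s in Ioo t r, L * expWeight L s) + expWeight L t = expWeight L r := by
  have hd (x : ℝ) : HasDerivAt (fun s : ℝ => Real.exp (L * s)) (L * Real.exp (L * x)) x := by
    simpa [mul_comm] using ((hasDerivAt_id x).const_mul (L : ℝ)).exp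
  have hi : IntervalIntegrable (fun s : ℝ => (L : ℝ) * Real.exp (L * s)) volume t r :=
    Continuous.intervalIntegrable (by fun_prop) _ _
  have h := intervalIntegral.integral_eq_sub_of_hasDerivAt (fun x _ => hd x) hi
  have h0 (x : ℝ) : 0 ≤ (L : ℝ) * Real.exp (L * x) := by positivity
  have hle : Real.exp (L * t) ≤ Real.exp (L * r) := by gcongr
  rw [intervalIntegral.integral_of_le htr.le] at h
  have e (s : ℝ) : (L : ℝ≥0∞) * expWeight L s = ENNReal.ofReal (L * Real.exp (L * s)) := by
    rw [ENNReal.ofReal_mul L.coe_nonneg, expWeight, ENNReal.ofReal_coe_nnreal]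
  simp_rw [e]
  rw [restrict_Ioo_eq_restrict_Ioc, ← ofReal_integral_eq_lintegral_ofReal
    ((intervalIntegrable_iff_integrableOn_Ioc_of_le htr.le).1 hi) (ae_of_all _ h0), h, expWeight,
    expWeight, ← ENNReal.ofReal_add (sub_nonneg.2 hle) (Real.exp_pos _).le]
  simp

/-- A driver which becomes increasing after adding a linear term, and is dominated by a
projectable process, has a projected fixed point. -/
theorem exists_isProj_fixedPoint {P : Measure Ω} [IsProbabilityMeasure P] {ℱ : Filtration ℝ m}
    {ℓ I : ℝ → Ω → ℝ≥0∞} (hℓ : IsProg ℱ ℓ) (hI : IsProj P ℱ ℓ I)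
    (hfin : ∫⁻ ω, (∫⁻ s in Ioi 0, ℓ s ω) ∂P < ∞) (hIfin : ∫⁻ ω, (∫⁻ s in Ioi 0, I s ω) ∂P < ∞)
    {f : ℝ → Ω → ℝ≥0∞ → ℝ≥0∞} {L C : NNReal}
    (hf : ∀ V, IsProg ℱ V → IsProg ℱ fun s ω => f s ω (V s ω))
    (hfc : ∀ s ω, 0 ≤ s → Continuous (f s ω)) (hfC : ∀ s ω w, 0 ≤ s → f s ω w ≤ C * ℓ s ω)
    (hmono : ∀ s ω, 0 ≤ s → Monotone fun w => f s ω w + L * w) :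
    ∃ V, IsProj P ℱ (fun s ω => f s ω (V s ω)) V ∧ ∀ t, 0 ≤ t → ∀ᵐ ω ∂P, V t ω ≤ C * I t ω := by
  let q : (ℝ → Ω → ℝ≥0∞) → ℝ → Ω → ℝ≥0∞ := fun V s ω =>
    expWeight (-L) s * (f s ω (V s ω) + L * V s ω)
  have hL {V : ℝ → Ω → ℝ≥0∞} (hV : IsProg ℱ V) : IsProg ℱ fun s ω => L * V s ω :=
    hV.comp (g := fun x => (L : ℝ≥0∞) * x) (by fun_prop)
  have hE (c : ℝ) {V : ℝ → Ω → ℝ≥0∞} (hV : IsProg ℱ V) : IsProg ℱ fun s ω => expWeight c s * V s ω :=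
    (IsProg.of_deterministic (measurable_expWeight c)).mul hV
  have hq {V : ℝ → Ω → ℝ≥0∞} (hV : IsProg ℱ V) : IsProg ℱ (q V) := hE _ ((hf V hV).add (hL hV))
  have hqm {V V' : ℝ → Ω → ℝ≥0∞} {s : ℝ} {ω : Ω} (hs : 0 ≤ s) (h : V s ω ≤ V' s ω) :
      q V s ω ≤ q V' s ω := mul_le_mul_right (hmono s ω hs h) _
  -- the bound `C * I` is a supersolution
  have hsuper {V : ℝ → Ω → ℝ≥0∞} (hV : IsProg ℱ V)
      (hVI : ∀ t, 0 ≤ t → ∀ᵐ ω ∂P, V t ω ≤ C * I t ω) {t : ℝ} (ht : 0 ≤ t) {Z : Ω → ℝ≥0∞}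
      (hZ : Measurable[ℱ t] Z) :
      ∫⁻ ω, Z ω * (∫⁻ s in Ioi t, q V s ω) ∂P ≤
        ∫⁻ ω, Z ω * (expWeight (-L) t * (C * I t ω)) ∂P := by
    have hD : IsProg ℱ fun s (_ : Ω) => discount (fun _ => (L : ℝ≥0∞)) t s :=
      (IsProg.of_deterministic (ℱ := ℱ) measurable_const).discount t
    have hcI : IsProg ℱ fun s ω => (discount (fun _ => (L : ℝ≥0∞)) t s * (ℓ s ω + L * I s ω)) :=
      hD.mul (hℓ.add (hL hI.isProg))
    have h := hI.lintegral_mul_discount hℓ (μ := fun _ _ => L)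
      (D := fun s _ => discount (fun _ => (L : ℝ≥0∞)) t s)
      (IsProg.of_deterministic measurable_const) hD ht
      (fun _ r hr => discount_add_setLIntegral measurable_const (fun _ => le_rfl) hr)
      (Z := fun ω => Z ω * (expWeight (-L) t * C)) (hZ.mul_const _)
    have e1 (ω : Ω) : Z ω * (expWeight (-L) t * (C * I t ω)) =
        Z ω * (expWeight (-L) t * C) * I t ω := by ring
    simp_rw [e1, h]
    have e2 (ω : Ω) : Z ω * (expWeight (-L) t * C) *
        ∫⁻ s in Ioi t, discount (fun _ => (L : ℝ≥0∞)) t s * (ℓ s ω + L * I s ω) =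
        Z ω * ∫⁻ s in Ioi t, expWeight (-L) s * (C * ℓ s ω + L * (C * I s ω)) := by
      rw [mul_assoc, ← lintegral_const_mul _ (hcI.measurable_path ω)]
      congr 1
      refine setLIntegral_congr_fun measurableSet_Ioi fun s (hs : t < s) => ?_
      rw [← expWeight_neg_mul_discount L hs.le]
      ring
    simp_rw [e2]
    have hC {V : ℝ → Ω → ℝ≥0∞} (hV : IsProg ℱ V) : IsProg ℱ fun s ω => C * V s ω :=
      hV.comp (g := fun x => (C : ℝ≥0∞) * x) (by fun_prop)
    refine lintegral_mul_tail_mono (hZ.mono (ℱ.le t) le_rfl) (hq hV).measurable_uncurry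
      (hE _ ((hC hℓ).add (hL (hC hI.isProg)))).measurable_uncurry ?_
    filter_upwards [ae_restrict_mem measurableSet_Ioi] with s (hs : t < s)
    filter_upwards [hVI s (ht.trans hs.le)] with ω hω
    exact mul_le_mul_right (add_le_add (hfC s ω _ (ht.trans hs.le)) (by gcongr)) _
  have hI0 : ∀ t, 0 ≤ t → ∫⁻ ω, expWeight (-L) t * (C * I t ω) ∂P < ∞ := fun t ht => by
    have h := hI.lintegral_mul hℓ ht (Z := fun _ => 1) measurable_const
    simp only [one_mul] at h
    simp_rw [← mul_assoc]
    rw [lintegral_const_mul _ (hI.isProg.measurable_apply' t), h]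
    exact ENNReal.mul_lt_top (ENNReal.mul_lt_top (expWeight_ne_top _ _).lt_top (by simp))
      (lt_of_le_of_lt (lintegral_mono fun ω => lintegral_mono_set (Ioi_subset_Ioi ht)) hfin)
  -- subsolutions and the improvement step
  let S : Set (ℝ → Ω → ℝ≥0∞) := {V | IsProg ℱ V ∧ (∀ t, 0 ≤ t → ∀ᵐ ω ∂P, V t ω ≤ C * I t ω) ∧
    ∀ t, 0 ≤ t → ∀ Z : Ω → ℝ≥0∞, Measurable[ℱ t] Z →
      ∫⁻ ω, Z ω * (expWeight (-L) t * V t ω) ∂P ≤ ∫⁻ ω, Z ω * (∫⁻ s in Ioi t, q V s ω) ∂P}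
  have hqfin {V : ℝ → Ω → ℝ≥0∞} (hV : V ∈ S) {t : ℝ} (ht : 0 ≤ t) :
      ∫⁻ ω, (∫⁻ s in Ioi t, q V s ω) ∂P < ∞ := by
    have h := hsuper hV.1 hV.2.1 ht (Z := fun _ => 1) measurable_const
    simp only [one_mul] at h
    exact lt_of_le_of_lt h (hI0 t ht)
  have hcancel (t : ℝ) {x y : ℝ≥0∞} (h : expWeight (-L) t * x ≤ expWeight (-L) t * y) : x ≤ y :=
    (ENNReal.mul_le_mul_iff_right (expWeight_pos _ _) (expWeight_ne_top _ _)).1 h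
  have step (V : S) : ∃ V' : S, (∀ t ω, V.1 t ω ≤ V'.1 t ω) ∧
      IsProj P ℱ (q V) fun t ω => expWeight (-L) t * V'.1 t ω := by
    obtain ⟨V, hV⟩ := V
    obtain ⟨Y, hY⟩ := exists_isProj (hq hV.1) (hqfin hV le_rfl)
    have hYm (t : ℝ) (ht : 0 ≤ t) : ∀ᵐ ω ∂P, expWeight (-L) t * V t ω ≤ Y t ω := by
      refine ae_le_of_lintegral_mul_le (ℱ.le t) ((hE _ hV.1).measurable_apply t)
        (hY.isProg.measurable_apply t) ?_ fun Z hZ _ => ?_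
      · have h := hY.lintegral_mul (hq hV.1) ht (Z := fun _ => 1) measurable_const
        simp only [one_mul] at h
        rw [h]
        exact (hqfin hV ht).ne
      · rw [hY.lintegral_mul (hq hV.1) ht hZ]
        exact hV.2.2 t ht Z hZ
    set V' : ℝ → Ω → ℝ≥0∞ := fun t ω => V t ω ⊔ expWeight L t * Y t ω with hV'
    have hV'p : IsProg ℱ V' := hV.1.max (hE _ hY.isProg)
    have hV'Y (t : ℝ) (ht : 0 ≤ t) : ∀ᵐ ω ∂P, expWeight (-L) t * V' t ω = Y t ω := by
      filter_upwards [hYm t ht] with ω hω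
      have e : expWeight (-L) t * (expWeight L t * Y t ω) = Y t ω := by
        rw [← mul_assoc, mul_comm (expWeight (-L) t), expWeight_mul_expWeight_neg, one_mul]
      rw [hV']
      dsimp only
      rw [sup_eq_right.2 (hcancel t (e.symm ▸ hω)), e]
    have hproj : IsProj P ℱ (q V) fun t ω => expWeight (-L) t * V' t ω :=
      ⟨hE _ hV'p, fun t ht =>
        Filter.EventuallyEq.trans (hV'Y t ht) (hY.ae_eq t ht)⟩
    have hle (t : ℝ) (ω : Ω) : V t ω ≤ V' t ω := le_sup_left
    refine ⟨⟨V', hV'p, fun t ht => ?_, fun t ht Z hZ => ?_⟩, hle, hproj⟩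
    · have h := ae_le_of_lintegral_mul_le (P := P) (ℱ.le t) (f := fun ω => expWeight (-L) t * V' t ω)
        (g := fun ω => expWeight (-L) t * (C * I t ω)) ((hE _ hV'p).measurable_apply t)
        (((hI.isProg.measurable_apply t).const_mul _).const_mul _) (hI0 t ht).ne fun Z hZ _ => by
          rw [hproj.lintegral_mul (hq hV.1) ht hZ]
          exact hsuper hV.1 hV.2.1 ht hZ
      filter_upwards [h] with ω hω
      exact hcancel t hω
    · rw [hproj.lintegral_mul (hq hV.1) ht hZ]
      refine lintegral_mul_tail_mono (hZ.mono (ℱ.le t) le_rfl) (hq hV.1).measurable_uncurry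
        (hq hV'p).measurable_uncurry ?_
      filter_upwards [ae_restrict_mem measurableSet_Ioi] with s (hs : t < s)
      exact ae_of_all _ fun ω => hqm (ht.trans hs.le) (hle s ω)
  choose next hnext_le hnext using step
  have h0 : (fun _ _ => 0 : ℝ → Ω → ℝ≥0∞) ∈ S :=
    ⟨IsProg.of_deterministic measurable_const, fun t _ => ae_of_all _ fun _ => zero_le,
      fun t _ Z _ => by simp⟩
  let v : ℕ → S := fun n => next^[n] ⟨_, h0⟩
  have hvs (n : ℕ) : v (n + 1) = next (v n) := Function.iterate_succ_apply' _ _ _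
  have hvm (t : ℝ) (ω : Ω) : Monotone fun n => (v n).1 t ω := monotone_nat_of_le_succ fun n => by
    rw [hvs]
    exact hnext_le _ t ω
  set V : ℝ → Ω → ℝ≥0∞ := fun t ω => ⨆ n, (v n).1 t ω with hVdef
  have hVp : IsProg ℱ V := IsProg.iSup fun n => (v n).2.1
  have hVI (t : ℝ) (ht : 0 ≤ t) : ∀ᵐ ω ∂P, V t ω ≤ C * I t ω := by
    filter_upwards [ae_all_iff.2 fun n => (v n).2.2.1 t ht] with ω hω
    exact iSup_le hω
  have hqV {s : ℝ} (hs : 0 ≤ s) (ω : Ω) : q V s ω = ⨆ n, q (v n).1 s ω := by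
    have hc : Continuous fun w => expWeight (-L) s * (f s ω w + L * w) :=
      (ENNReal.continuous_const_mul (expWeight_ne_top _ _)).comp
        ((hfc s ω hs).add (ENNReal.continuous_const_mul ENNReal.coe_ne_top))
    exact tendsto_nhds_unique ((hc.tendsto _).comp (tendsto_atTop_iSup (hvm s ω)))
      (tendsto_atTop_iSup fun i j hij => hqm hs (hvm s ω hij))
  have hfix (t : ℝ) (ht : 0 ≤ t) (Z : Ω → ℝ≥0∞) (hZ : Measurable[ℱ t] Z) :
      ∫⁻ ω, Z ω * (expWeight (-L) t * V t ω) ∂P = ∫⁻ ω, Z ω * (∫⁻ s in Ioi t, q V s ω) ∂P := by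
    have hZ' : Measurable Z := hZ.mono (ℱ.le t) le_rfl
    have e1 (ω : Ω) : Z ω * (expWeight (-L) t * V t ω) =
        ⨆ n, Z ω * (expWeight (-L) t * (v n).1 t ω) := by
      simp only [hVdef, ENNReal.mul_iSup]
    have e2 (ω : Ω) : Z ω * ∫⁻ s in Ioi t, q V s ω = ⨆ n, Z ω * ∫⁻ s in Ioi t, q (v n).1 s ω := by
      rw [← ENNReal.mul_iSup, setLIntegral_congr_fun measurableSet_Ioi
        fun s (hs : t < s) => hqV (ht.trans hs.le) ω]
      congr 1
      refine lintegral_iSup' (fun n => ((hq (v n).2.1).measurable_path ω).aemeasurable) ?_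
      filter_upwards [ae_restrict_mem measurableSet_Ioi] with s (hs : t < s)
      exact fun i j hij => hqm (ht.trans hs.le) (hvm s ω hij)
    have hm1 : Monotone fun n ω => Z ω * (expWeight (-L) t * (v n).1 t ω) :=
      fun i j hij ω => by
        have := hvm t ω hij
        dsimp only at this ⊢
        gcongr
    have hm2 : Monotone fun n ω => Z ω * ∫⁻ s in Ioi t, q (v n).1 s ω := fun i j hij ω =>
      mul_le_mul_right (setLIntegral_mono ((hq (v j).2.1).measurable_path ω)
        fun s (hs : t < s) => hqm (ht.trans hs.le) (hvm s ω hij)) _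
    simp_rw [e1, e2]
    rw [lintegral_iSup (f := fun n ω => Z ω * (expWeight (-L) t * (v n).1 t ω))
        (fun n => hZ'.mul ((hE _ (v n).2.1).measurable_apply' t)) hm1,
      lintegral_iSup (f := fun n ω => Z ω * ∫⁻ s in Ioi t, q (v n).1 s ω) (fun n => hZ'.mul
        (measurable_setLIntegral_left (hq (v n).2.1).measurable_uncurry _)) hm2]
    have hs (n : ℕ) : ∫⁻ ω, Z ω * (expWeight (-L) t * (v (n + 1)).1 t ω) ∂P =
        ∫⁻ ω, Z ω * (∫⁻ s in Ioi t, q (v n).1 s ω) ∂P := by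
      rw [hvs]
      exact (hnext (v n)).lintegral_mul (hq (v n).2.1) ht hZ
    refine le_antisymm (iSup_le fun n => ?_) (iSup_le fun n => ?_)
    · exact ((v n).2.2.2 t ht Z hZ).trans
        (le_iSup (fun n => ∫⁻ ω, Z ω * (∫⁻ s in Ioi t, q (v n).1 s ω) ∂P) n)
    · rw [← hs]
      exact le_iSup (fun n => ∫⁻ ω, Z ω * (expWeight (-L) t * (v n).1 t ω) ∂P) (n + 1)
  have hproj : IsProj P ℱ (q V) fun t ω => expWeight (-L) t * V t ω :=
    IsProj.of_setLIntegral (hE _ hVp) fun t ht Z hZ _ => hfix t ht Z hZ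
  refine ⟨V, IsProj.of_setLIntegral hVp fun t ht Z hZ hZ1 => ?_, hVI⟩
  have hZ' : Measurable Z := hZ.mono (ℱ.le t) le_rfl
  have hLV : Measurable fun ω => Z ω * ∫⁻ s in Ioi t, L * V s ω :=
    hZ'.mul (measurable_setLIntegral_left (hL hVp).measurable_uncurry _)
  have hLVfin : ∫⁻ ω, Z ω * (∫⁻ s in Ioi t, L * V s ω) ∂P ≠ ∞ := by
    have h : ∫⁻ ω, Z ω * (∫⁻ s in Ioi t, L * V s ω) ∂P ≤
        ∫⁻ ω, Z ω * (∫⁻ s in Ioi t, L * C * I s ω) ∂P := by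
      refine lintegral_mul_tail_mono hZ' (hL hVp).measurable_uncurry
        (hI.isProg.measurable_uncurry.const_mul _) ?_
      filter_upwards [ae_restrict_mem measurableSet_Ioi] with s (hs : t < s)
      filter_upwards [hVI s (ht.trans hs.le)] with ω hω
      rw [mul_assoc]
      gcongr
    refine ne_top_of_le_ne_top ?_ (h.trans (lintegral_mono (g := fun ω =>
      L * C * ∫⁻ s in Ioi 0, I s ω) fun ω => ?_))
    · rw [lintegral_const_mul _ (measurable_setLIntegral_left hI.isProg.measurable_uncurry _)]
      exact (ENNReal.mul_lt_top (by simp [ENNReal.mul_lt_top]) hIfin).ne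
    · refine (mul_le_of_le_one_left' (hZ1 ω)).trans ?_
      rw [lintegral_const_mul _ (hI.isProg.measurable_path ω)]
      exact mul_le_mul_right (lintegral_mono_set (Ioi_subset_Ioi ht)) _
  have hT := hproj.lintegral_mul_Ioi_mul (hq hVp) (w := fun s _ => L * expWeight L s)
    (IsProg.of_deterministic (by fun_prop)) ht hZ
  have hA := hproj.lintegral_mul (hq hVp) ht (Z := fun ω => Z ω * expWeight L t) (hZ.mul_const _)
  have hmT : Measurable fun ω => Z ω * ∫⁻ r in Ioi t,
      (∫⁻ s in Ioo t r, L * expWeight L s) * q V r ω := by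
    have : Measurable fun r : ℝ => ∫⁻ s in Ioo t r, L * expWeight L s := by
      simp_rw [restrict_Ioo_eq_restrict_Ioc]
      exact ((IsProg.of_deterministic (ℱ := ℱ) (by fun_prop)).lintegral_Ioc t).measurable_path
        (nonempty_of_isProbabilityMeasure P).some
    exact hZ'.mul (measurable_setLIntegral_left
      ((this.comp measurable_fst).mul (hq hVp).measurable_uncurry) _)
  have hsum : ∫⁻ ω, Z ω * (∫⁻ s in Ioi t, L * V s ω) ∂P + ∫⁻ ω, Z ω * V t ω ∂P =
      ∫⁻ ω, Z ω * (∫⁻ s in Ioi t, L * V s ω) ∂P +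
        ∫⁻ ω, Z ω * (∫⁻ s in Ioi t, f s ω (V s ω)) ∂P := by
    have e1 : ∫⁻ ω, Z ω * (∫⁻ s in Ioi t, L * V s ω) ∂P =
        ∫⁻ ω, Z ω * (∫⁻ s in Ioi t, L * expWeight L s * (expWeight (-L) s * V s ω)) ∂P := by
      refine lintegral_congr fun ω => ?_
      congr 1
      refine lintegral_congr fun s => ?_
      rw [mul_assoc, ← mul_assoc (expWeight L s), expWeight_mul_expWeight_neg, one_mul]
    have e2 : ∫⁻ ω, Z ω * V t ω ∂P =
        ∫⁻ ω, Z ω * expWeight L t * (expWeight (-L) t * V t ω) ∂P := by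
      refine lintegral_congr fun ω => ?_
      rw [mul_assoc, ← mul_assoc (expWeight L t), expWeight_mul_expWeight_neg, one_mul]
    conv_lhs => rw [e1, e2, hT, hA, ← lintegral_add_left hmT]
    rw [← lintegral_add_left hLV]
    refine lintegral_congr fun ω => ?_
    rw [mul_assoc, ← mul_add, ← mul_add, ← lintegral_const_mul _ ((hq hVp).measurable_path ω),
      ← lintegral_add_right _ (((hq hVp).measurable_path ω).const_mul _),
      ← lintegral_add_left ((hL hVp).measurable_path ω)]
    congr 1
    refine setLIntegral_congr_fun measurableSet_Ioi fun r hr => ?_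
    rw [← add_mul, setLIntegral_mul_expWeight L hr, ← mul_assoc, expWeight_mul_expWeight_neg,
      one_mul, add_comm]
  exact (ENNReal.add_right_inj hLVfin).1 hsum

/-- Tangent line bound for a negative power on `[κ, ∞)`. -/
theorem rpow_sub_rpow_le_of_neg {ρ κ a b : ℝ} (hρ : ρ < 0) (hκ : 0 < κ) (ha : κ ≤ a) (hab : a ≤ b) :
    a ^ ρ ≤ b ^ ρ + -ρ * κ ^ (ρ - 1) * (b - a) := by
  have ha0 : 0 < a := hκ.trans_le ha
  have h1 : 1 + ρ * (b / a - 1) ≤ (b / a) ^ ρ := by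
    have hx : 0 < b / a := div_pos (ha0.trans_le hab) ha0
    have h := Real.add_one_le_exp (ρ * Real.log (b / a))
    have h' := Real.log_le_sub_one_of_pos hx
    rw [Real.rpow_def_of_pos hx, mul_comm (Real.log _)]
    nlinarith
  have h2 : b ^ ρ = a ^ ρ * (b / a) ^ ρ := by
    rw [← Real.mul_rpow ha0.le (div_nonneg (ha0.le.trans hab) ha0.le), mul_div_cancel₀ _ ha0.ne']
  have h3 : a ^ (ρ - 1) ≤ κ ^ (ρ - 1) := Real.rpow_le_rpow_of_nonpos hκ ha (by linarith)
  have h4 : a ^ ρ = a ^ (ρ - 1) * a := by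
    rw [← Real.rpow_add_one ha0.ne', sub_add_cancel]
  have h5 : a ^ ρ * (1 + ρ * (b / a - 1)) = a ^ ρ + ρ * a ^ (ρ - 1) * (b - a) := by
    rw [h4]
    field_simp
  have h6 := mul_le_mul_of_nonneg_left h1 (Real.rpow_nonneg ha0.le ρ)
  rw [h5, ← h2] at h6
  have h7 := mul_le_mul_of_nonneg_right h3 (mul_nonneg (neg_nonneg.2 hρ.le) (sub_nonneg.2 hab))
  nlinarith

theorem monotone_max_rpow_add_mul {ρ : ℝ} (hρ : ρ < 0) {κ : ℝ≥0∞} (h0 : κ ≠ 0) (h1 : κ ≠ ∞) :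
    Monotone fun w : ℝ≥0∞ => (max w κ) ^ ρ + ENNReal.ofReal (-ρ) * κ ^ (ρ - 1) * w := by
  intro x y hxy
  dsimp only
  rcases eq_or_ne y ∞ with rfl | hy
  · have : ENNReal.ofReal (-ρ) * κ ^ (ρ - 1) ≠ 0 := by
      refine mul_ne_zero (by simpa using hρ) ?_
      simp [ENNReal.rpow_eq_zero_iff, h0, h1]
    rw [ENNReal.mul_top this, add_top]
    exact le_top
  have hx : x ≠ ∞ := ne_top_of_le_ne_top hy hxy
  lift x to NNReal using hx
  lift y to NNReal using hy
  lift κ to NNReal using h1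
  have hκ : 0 < κ := pos_iff_ne_zero.2 (by simpa using h0)
  have hxy' : x ≤ y := by exact_mod_cast hxy
  have hm : max (x : ℝ) κ ≤ max (y : ℝ) κ := max_le_max_right _ (by exact_mod_cast hxy')
  have hκ' : (0 : ℝ) < κ := by exact_mod_cast hκ
  have h := rpow_sub_rpow_le_of_neg hρ hκ' (le_max_right (x : ℝ) κ) hm
  have hd : max (y : ℝ) κ - max (x : ℝ) κ ≤ y - x := by
    have hxy'' : (x : ℝ) ≤ y := by exact_mod_cast hxy'
    rcases max_cases (y : ℝ) κ with h | h <;> rcases max_cases (x : ℝ) κ with h' | h' <;> linarith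
  have h2 := mul_le_mul_of_nonneg_left hd
    (mul_nonneg (neg_nonneg.2 hρ.le) (Real.rpow_nonneg hκ'.le (ρ - 1)))
  have e (z : NNReal) : (max (z : ℝ≥0∞) κ) ^ ρ + ENNReal.ofReal (-ρ) * (κ : ℝ≥0∞) ^ (ρ - 1) * z =
      ENNReal.ofReal ((max (z : ℝ) κ) ^ ρ + -ρ * (κ : ℝ) ^ (ρ - 1) * z) := by
    have hc : max (z : ℝ≥0∞) κ = ENNReal.ofReal (max (z : ℝ) κ) := by
      rw [ENNReal.ofReal_max, ENNReal.ofReal_coe_nnreal, ENNReal.ofReal_coe_nnreal]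
    have hκρ : 0 ≤ -ρ * (κ : ℝ) ^ (ρ - 1) :=
      mul_nonneg (neg_nonneg.2 hρ.le) (Real.rpow_nonneg hκ'.le _)
    rw [ENNReal.ofReal_add (Real.rpow_nonneg (le_max_of_le_right hκ'.le) _)
      (mul_nonneg hκρ z.coe_nonneg), ENNReal.ofReal_mul hκρ,
      ENNReal.ofReal_mul (neg_nonneg.2 hρ.le), ENNReal.ofReal_coe_nnreal,
      ← ENNReal.ofReal_rpow_of_pos hκ', ENNReal.ofReal_coe_nnreal, hc,
      ENNReal.ofReal_rpow_of_pos (lt_max_of_lt_right hκ')]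
  rw [e, e]
  exact ENNReal.ofReal_le_ofReal (by linarith)

theorem rpow_le_rpow_of_neg {ρ : ℝ} (hρ : ρ < 0) {x y : ℝ≥0∞} (h : x ≤ y) : y ^ ρ ≤ x ^ ρ := by
  have e (z : ℝ≥0∞) : z ^ ρ = (z ^ (-ρ))⁻¹ := by rw [← ENNReal.rpow_neg, neg_neg]
  rw [e, e]
  exact ENNReal.inv_le_inv.2 (ENNReal.rpow_le_rpow h (neg_nonneg.2 hρ.le))

theorem mul_rpow_le_of_le {ρ r : ℝ} {u ℓ : ℝ≥0∞} {K δ : NNReal} (hδ : δ ≠ 0) (h0 : ℓ ≠ 0)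
    (h1 : ℓ ≠ ∞) (hu : u ≤ K * ℓ ^ (1 - ρ)) :
    u * (δ * ℓ) ^ r ≤ (K * δ ^ r : NNReal) * ℓ ^ (1 - ρ + r) := by
  rw [ENNReal.mul_rpow_of_ne_top (by simp) h1, ENNReal.rpow_add _ _ h0 h1, ENNReal.coe_mul,
    ENNReal.coe_rpow_of_ne_zero hδ]
  calc u * ((δ : ℝ≥0∞) ^ r * ℓ ^ r) ≤ K * ℓ ^ (1 - ρ) * ((δ : ℝ≥0∞) ^ r * ℓ ^ r) := by gcongr
    _ = _ := by ring

theorem lintegral_mul_tail_congr {P : Measure Ω} [IsProbabilityMeasure P] {ℱ : Filtration ℝ m}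
    {a a' : ℝ → Ω → ℝ≥0∞} (ha : IsProg ℱ a) (ha' : IsProg ℱ a')
    (h : ∀ s, 0 ≤ s → a s =ᵐ[P] a' s) {t : ℝ} (ht : 0 ≤ t) {Z : Ω → ℝ≥0∞} (hZ : Measurable Z) :
    ∫⁻ ω, Z ω * (∫⁻ s in Ioi t, a s ω) ∂P = ∫⁻ ω, Z ω * (∫⁻ s in Ioi t, a' s ω) ∂P := by
  refine le_antisymm (lintegral_mul_tail_mono hZ ha.measurable_uncurry ha'.measurable_uncurry ?_)
    (lintegral_mul_tail_mono hZ ha'.measurable_uncurry ha.measurable_uncurry ?_) <;>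
  filter_upwards [ae_restrict_mem measurableSet_Ioi] with s (hs : t < s)
  · exact (h s (ht.trans hs.le)).le
  · exact (h s (ht.trans hs.le)).symm.le

theorem IsProj.congr {P : Measure Ω} [IsProbabilityMeasure P] {ℱ : Filtration ℝ m}
    {a a' V V' : ℝ → Ω → ℝ≥0∞} (hV : IsProj P ℱ a V) (ha : IsProg ℱ a) (ha' : IsProg ℱ a')
    (hV' : IsProg ℱ V') (h : ∀ s, 0 ≤ s → a s =ᵐ[P] a' s) (hVV' : ∀ s, 0 ≤ s → V s =ᵐ[P] V' s) :
    IsProj P ℱ a' V' := by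
  refine IsProj.of_setLIntegral hV' fun t ht Z hZ _ => ?_
  rw [← lintegral_mul_tail_congr ha ha' h ht (hZ.mono (ℱ.le t) le_rfl), ← hV.lintegral_mul ha ht hZ]
  refine lintegral_congr_ae ?_
  filter_upwards [hVV' t ht] with ω hω
  rw [hω]

/-- Existence of a fixed point for the aggregator `u * w ^ ρ` perturbed by `ε * ℓ`. -/
theorem exists_isProj_rpow_add {P : Measure Ω} [IsProbabilityMeasure P] {ℱ : Filtration ℝ m}
    {ℓ I u : ℝ → Ω → ℝ≥0∞} (hℓ : IsProg ℱ ℓ) (hI : IsProj P ℱ ℓ I)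
    (hfin : ∫⁻ ω, (∫⁻ s in Ioi 0, ℓ s ω) ∂P < ∞) (hIfin : ∫⁻ ω, (∫⁻ s in Ioi 0, I s ω) ∂P < ∞)
    (hℓ0 : ∀ s ω, ℓ s ω ≠ 0) (hℓt : ∀ s ω, ℓ s ω ≠ ∞) {ρ : ℝ} (hρ : ρ < 0) {K K' : NNReal}
    (hK' : K' ≠ 0) (hℓI : ∀ t, 0 ≤ t → ∀ᵐ ω ∂P, ℓ t ω ≤ K' * I t ω) (hu : IsProg ℱ u)
    (hut : ∀ s ω, u s ω ≠ ∞) (huℓ : ∀ s ω, 0 ≤ s → u s ω ≤ K * ℓ s ω ^ (1 - ρ)) {ε : NNReal}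
    (hε : ε ≠ 0) :
    ∃ W, IsProj P ℱ (fun s ω => u s ω * W s ω ^ ρ + ε * ℓ s ω) W ∧
      ∫⁻ ω, (∫⁻ s in Ioi 0, u s ω * W s ω ^ ρ + ε * ℓ s ω) ∂P < ∞ := by
  set δ : NNReal := ε / K' with hδdef
  have hδ : δ ≠ 0 := div_ne_zero hε hK'
  have hκ0 (s : ℝ) (ω : Ω) : (δ : ℝ≥0∞) * ℓ s ω ≠ 0 := mul_ne_zero (by simpa using hδ) (hℓ0 s ω)
  have hκt (s : ℝ) (ω : Ω) : (δ : ℝ≥0∞) * ℓ s ω ≠ ∞ := ENNReal.mul_ne_top (by simp) (hℓt s ω)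
  have hc (c : NNReal) {V : ℝ → Ω → ℝ≥0∞} (hV : IsProg ℱ V) : IsProg ℱ fun s ω => c * V s ω :=
    hV.comp (g := fun x => (c : ℝ≥0∞) * x) (by fun_prop)
  have hr {V : ℝ → Ω → ℝ≥0∞} (hV : IsProg ℱ V) : IsProg ℱ fun s ω => V s ω ^ ρ :=
    hV.comp (g := fun x => x ^ ρ) (by fun_prop)
  let f : ℝ → Ω → ℝ≥0∞ → ℝ≥0∞ := fun s ω w => u s ω * (max w (δ * ℓ s ω)) ^ ρ + ε * ℓ s ω
  have hf {V : ℝ → Ω → ℝ≥0∞} (hV : IsProg ℱ V) : IsProg ℱ fun s ω => f s ω (V s ω) :=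
    (hu.mul (hr (hV.max (hc δ hℓ)))).add (hc ε hℓ)
  obtain ⟨W, hW, hWI⟩ := exists_isProj_fixedPoint (L := Real.toNNReal (-ρ) * (K * δ ^ (ρ - 1)))
    (C := K * δ ^ ρ + ε) hℓ hI hfin hIfin (f := f) (fun V hV => hf hV)
    (fun s ω _ => ((ENNReal.continuous_const_mul (hut s ω)).comp
      (ENNReal.continuous_rpow_const.comp (continuous_id.max continuous_const))).add
        continuous_const)
    (fun s ω w hs => by
      have h := mul_rpow_le_of_le (r := ρ) hδ (hℓ0 s ω) (hℓt s ω) (huℓ s ω hs)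
      rw [sub_add_cancel, ENNReal.rpow_one] at h
      rw [ENNReal.coe_add, add_mul]
      refine add_le_add (le_trans ?_ h) le_rfl
      exact mul_le_mul_right (rpow_le_rpow_of_neg hρ (le_max_right _ _)) _)
    (fun s ω hs x y hxy => by
      have h := mul_rpow_le_of_le (r := ρ - 1) hδ (hℓ0 s ω) (hℓt s ω) (huℓ s ω hs)
      rw [show 1 - ρ + (ρ - 1) = 0 by ring, ENNReal.rpow_zero, mul_one] at h
      obtain ⟨c, hc⟩ := exists_add_of_le h
      have hm := monotone_max_rpow_add_mul hρ (hκ0 s ω) (hκt s ω) hxy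
      dsimp only at hm
      have e (w : ℝ≥0∞) : f s ω w +
          (Real.toNNReal (-ρ) * (K * δ ^ (ρ - 1)) : NNReal) * w =
          u s ω * ((max w (δ * ℓ s ω)) ^ ρ +
            ENNReal.ofReal (-ρ) * (δ * ℓ s ω) ^ (ρ - 1) * w) +
            (ENNReal.ofReal (-ρ) * c * w + ε * ℓ s ω) := by
        rw [ENNReal.coe_mul, hc]
        simp only [f, ENNReal.ofReal]
        ring
      dsimp only
      rw [e, e]
      gcongr)
  have h0 : ∫⁻ ω, W 0 ω ∂P < ∞ := by
    have h := hI.lintegral_mul hℓ le_rfl (Z := fun _ => 1) measurable_const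
    simp only [one_mul] at h
    refine lt_of_le_of_lt (lintegral_mono_ae (hWI 0 le_rfl)) ?_
    rw [lintegral_const_mul _ (hI.isProg.measurable_apply' 0), h]
    exact ENNReal.mul_lt_top ENNReal.coe_lt_top hfin
  have hfW : IsProg ℱ fun s ω => f s ω (W s ω) := hf hW.isProg
  have hfWfin : ∫⁻ ω, (∫⁻ s in Ioi 0, f s ω (W s ω)) ∂P < ∞ := by
    have h := hW.lintegral_mul hfW le_rfl (Z := fun _ => 1) measurable_const
    simp only [one_mul] at h
    rwa [← h]
  have hlow (t : ℝ) (ht : 0 ≤ t) : ∀ᵐ ω ∂P, δ * ℓ t ω ≤ W t ω := by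
    have h : ∀ᵐ ω ∂P, ε * I t ω ≤ W t ω := by
      refine ae_le_of_lintegral_mul_le (ℱ.le t) ((hc ε hI.isProg).measurable_apply t)
        (hW.isProg.measurable_apply t) ?_ fun Z hZ _ => ?_
      · have h := hW.lintegral_mul hfW ht (Z := fun _ => 1) measurable_const
        simp only [one_mul] at h
        rw [h]
        exact ne_top_of_le_ne_top hfWfin.ne
          (lintegral_mono fun ω => lintegral_mono_set (Ioi_subset_Ioi ht))
      · have e (ω : Ω) : Z ω * (ε * I t ω) = Z ω * ε * I t ω := by ring
        simp_rw [e]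
        rw [hI.lintegral_mul hℓ ht (hZ.mul_const _), hW.lintegral_mul hfW ht hZ]
        refine lintegral_mono fun ω => ?_
        rw [mul_assoc, ← lintegral_const_mul _ (hℓ.measurable_path ω)]
        exact mul_le_mul_right (lintegral_mono fun s => le_add_self) _
    filter_upwards [h, hℓI t ht] with ω h1 h2
    calc (δ : ℝ≥0∞) * ℓ t ω ≤ δ * (K' * I t ω) := by gcongr
      _ = ε * I t ω := by
        rw [← mul_assoc, ← ENNReal.coe_mul, hδdef, div_mul_cancel₀ _ hK']
      _ ≤ W t ω := h1
  have hg : IsProg ℱ fun s ω => u s ω * W s ω ^ ρ + ε * ℓ s ω :=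
    (hu.mul (hr hW.isProg)).add (hc ε hℓ)
  have hfg (s : ℝ) (hs : 0 ≤ s) :
      (fun ω => f s ω (W s ω)) =ᵐ[P] fun ω => u s ω * W s ω ^ ρ + ε * ℓ s ω := by
    filter_upwards [hlow s hs] with ω hω
    simp only [f, max_eq_left hω]
  refine ⟨W, hW.congr hfW hg hW.isProg hfg fun _ _ => ae_eq_refl _, ?_⟩
  have h := lintegral_mul_tail_congr hfW hg hfg le_rfl (Z := fun _ => 1) measurable_const
  simp only [one_mul] at h
  rwa [← h]

/-- Existence of a fixed point for the aggregator `u * w ^ ρ`, as a decreasing limit of the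
solutions of the perturbed problems. -/
theorem exists_isProj_rpow {P : Measure Ω} [IsProbabilityMeasure P] {ℱ : Filtration ℝ m}
    {ℓ I u : ℝ → Ω → ℝ≥0∞} (hℓ : IsProg ℱ ℓ) (hI : IsProj P ℱ ℓ I)
    (hfin : ∫⁻ ω, (∫⁻ s in Ioi 0, ℓ s ω) ∂P < ∞) (hIfin : ∫⁻ ω, (∫⁻ s in Ioi 0, I s ω) ∂P < ∞)
    (hℓ0 : ∀ s ω, ℓ s ω ≠ 0) (hℓt : ∀ s ω, ℓ s ω ≠ ∞) {ρ : ℝ} (hρ : ρ < 0) {K K' : NNReal}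
    (hK' : K' ≠ 0) (hℓI : ∀ t, 0 ≤ t → ∀ᵐ ω ∂P, ℓ t ω ≤ K' * I t ω) (hu : IsProg ℱ u)
    (hut : ∀ s ω, u s ω ≠ ∞) (huℓ : ∀ s ω, 0 ≤ s → u s ω ≤ K * ℓ s ω ^ (1 - ρ)) :
    ∃ W, IsProj P ℱ (fun s ω => u s ω * W s ω ^ ρ) W ∧
      ∫⁻ ω, (∫⁻ s in Ioi 0, u s ω * W s ω ^ ρ) ∂P < ∞ := by
  let ε : ℕ → NNReal := fun n => 1 / (n + 1)
  have hε (n : ℕ) : ε n ≠ 0 := (div_pos one_pos (by positivity)).ne'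
  have hεm : Antitone ε := fun i j hij => by
    dsimp only [ε]
    gcongr
  have hε0 : Tendsto (fun n => (ε n : ℝ≥0∞)) atTop (nhds 0) :=
    ENNReal.tendsto_coe.2 (tendsto_one_div_add_atTop_nhds_zero_nat (𝕜 := NNReal))
  have hc (c : NNReal) {V : ℝ → Ω → ℝ≥0∞} (hV : IsProg ℱ V) : IsProg ℱ fun s ω => c * V s ω :=
    hV.comp (g := fun x => (c : ℝ≥0∞) * x) (by fun_prop)
  have hb {V : ℝ → Ω → ℝ≥0∞} (hV : IsProg ℱ V) : IsProg ℱ fun s ω => u s ω * V s ω ^ ρ :=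
    hu.mul (hV.comp (g := fun x => x ^ ρ) (by fun_prop))
  have hbm {V V' : ℝ → Ω → ℝ≥0∞} (s : ℝ) (ω : Ω) (h : V s ω ≤ V' s ω) :
      u s ω * V' s ω ^ ρ ≤ u s ω * V s ω ^ ρ := mul_le_mul_right (rpow_le_rpow_of_neg hρ h) _
  choose w hw hwfin using fun n =>
    exists_isProj_rpow_add hℓ hI hfin hIfin hℓ0 hℓt hρ hK' hℓI hu hut huℓ (hε n)
  have hanti (t : ℝ) (ht : 0 ≤ t) : ∀ᵐ ω ∂P, Antitone fun n => w n t ω := by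
    have h (n : ℕ) : ∀ᵐ ω ∂P, w (n + 1) t ω ≤ w n t ω :=
      IsProj.comparison (hb (hw n).isProg) (hb (hw (n + 1)).isProg) (hc _ hℓ) (hc _ hℓ) (hw n)
        (hw (n + 1)) (hwfin n) (hwfin (n + 1)) hbm hbm
        (fun s ω => by gcongr; exact hεm n.le_succ) ht
    filter_upwards [ae_all_iff.2 h] with ω hω
    exact antitone_nat_of_succ_le hω
  -- the running infima are versions of `w n` which decrease everywhere
  let v : ℕ → ℝ → Ω → ℝ≥0∞ := fun n t ω => ⨅ j, w (min j n) t ω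
  have hvp (n : ℕ) : IsProg ℱ (v n) := IsProg.iInf fun j => (hw (min j n)).isProg
  have hvm (t : ℝ) (ω : Ω) : Antitone fun n => v n t ω := fun i j hij => le_iInf fun k => by
    refine (iInf_le _ (min k i)).trans (le_of_eq ?_)
    rw [min_assoc, min_eq_left hij]
  have hwv (n : ℕ) (t : ℝ) (ht : 0 ≤ t) : w n t =ᵐ[P] v n t := by
    filter_upwards [hanti t ht] with ω hω
    refine le_antisymm (le_iInf fun j => hω (min_le_right j n)) ((iInf_le _ n).trans (le_of_eq ?_))
    rw [min_self]
  have hv (n : ℕ) : IsProj P ℱ (fun s ω => u s ω * v n s ω ^ ρ + ε n * ℓ s ω) (v n) := by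
    refine (hw n).congr ((hb (hw n).isProg).add (hc _ hℓ)) ((hb (hvp n)).add (hc _ hℓ)) (hvp n)
      (fun s hs => ?_) (hwv n)
    filter_upwards [hwv n s hs] with ω hω
    rw [hω]
  have hv0 (t : ℝ) (ht : 0 ≤ t) : ∫⁻ ω, v 0 t ω ∂P < ∞ := by
    have h := (hw 0).lintegral_mul ((hb (hw 0).isProg).add (hc _ hℓ)) ht (Z := fun _ => 1)
      measurable_const
    simp only [one_mul] at h
    rw [← lintegral_congr_ae (hwv 0 t ht), h]
    exact lt_of_le_of_lt (lintegral_mono fun ω => lintegral_mono_set (Ioi_subset_Ioi ht)) (hwfin 0)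
  set W : ℝ → Ω → ℝ≥0∞ := fun t ω => ⨅ n, v n t ω with hWdef
  have hWp : IsProg ℱ W := IsProg.iInf hvp
  have hW : IsProj P ℱ (fun s ω => u s ω * W s ω ^ ρ) W := by
    refine IsProj.of_setLIntegral hWp fun t ht Z hZ hZ1 => ?_
    have hZ' : Measurable Z := hZ.mono (ℱ.le t) le_rfl
    have hZt (ω : Ω) : Z ω ≠ ∞ := ne_top_of_le_ne_top ENNReal.one_ne_top (hZ1 ω)
    have hlim1 : Tendsto (fun n => ∫⁻ ω, Z ω * v n t ω ∂P) atTop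
        (nhds (∫⁻ ω, Z ω * W t ω ∂P)) := by
      refine lintegral_tendsto_of_tendsto_of_antitone
        (fun n => (hZ'.mul ((hvp n).measurable_apply' t)).aemeasurable)
        (ae_of_all _ fun ω i j hij => mul_le_mul_right (hvm t ω hij) _)
        (ne_top_of_le_ne_top (hv0 t ht).ne (lintegral_mono fun ω => mul_le_of_le_one_left' (hZ1 ω)))
        (ae_of_all _ fun ω => ENNReal.Tendsto.const_mul (tendsto_atTop_iInf (hvm t ω))
          (Or.inr (hZt ω)))
    have hlim2 : Tendsto (fun n => ∫⁻ ω, Z ω * (∫⁻ s in Ioi t, u s ω * v n s ω ^ ρ) ∂P) atTop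
        (nhds (∫⁻ ω, Z ω * (∫⁻ s in Ioi t, u s ω * W s ω ^ ρ) ∂P)) := by
      refine lintegral_tendsto_of_tendsto_of_monotone
        (fun n => (hZ'.mul
          (measurable_setLIntegral_left (hb (hvp n)).measurable_uncurry _)).aemeasurable)
        (ae_of_all _ fun ω i j hij => mul_le_mul_right
          (lintegral_mono fun s => hbm s ω (hvm s ω hij)) _)
        (ae_of_all _ fun ω => ENNReal.Tendsto.const_mul ?_ (Or.inr (hZt ω)))
      exact lintegral_tendsto_of_tendsto_of_monotone
        (fun n => ((hb (hvp n)).measurable_path ω).aemeasurable)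
        (ae_of_all _ fun s i j hij => hbm s ω (hvm s ω hij))
        (ae_of_all _ fun s => ENNReal.Tendsto.const_mul
          ((ENNReal.continuous_rpow_const.tendsto _).comp (tendsto_atTop_iInf (hvm s ω)))
          (Or.inr (hut s ω)))
    have hℓZ : ∫⁻ ω, Z ω * (∫⁻ s in Ioi t, ℓ s ω) ∂P ≠ ∞ :=
      ne_top_of_le_ne_top hfin.ne (lintegral_mono fun ω =>
        (mul_le_of_le_one_left' (hZ1 ω)).trans (lintegral_mono_set (Ioi_subset_Ioi ht)))
    have hlim3 := hlim2.add (ENNReal.Tendsto.mul_const hε0 (Or.inr hℓZ))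
    rw [zero_mul, add_zero] at hlim3
    refine tendsto_nhds_unique hlim1 (hlim3.congr fun n => ?_)
    rw [(hv n).lintegral_mul ((hb (hvp n)).add (hc _ hℓ)) ht hZ,
      ← lintegral_const_mul (f := fun ω => Z ω * ∫⁻ s in Ioi t, ℓ s ω) _
        (hZ'.mul (measurable_setLIntegral_left hℓ.measurable_uncurry _)),
      ← lintegral_add_left (f := fun ω => Z ω * ∫⁻ s in Ioi t, u s ω * v n s ω ^ ρ)
        (hZ'.mul (measurable_setLIntegral_left (hb (hvp n)).measurable_uncurry _))]
    refine lintegral_congr fun ω => ?_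
    rw [lintegral_add_left ((hb (hvp n)).measurable_path ω),
      lintegral_const_mul _ (hℓ.measurable_path ω)]
    ring
  refine ⟨W, hW, ?_⟩
  have h := hW.lintegral_mul (hb hWp) le_rfl (Z := fun _ => 1) measurable_const
  simp only [one_mul] at h
  rw [← h]
  exact lt_of_le_of_lt (lintegral_mono fun ω => iInf_le _ 0) (hv0 0 le_rfl)

theorem IsProj.ae_eq_ofReal_condExp {P : Measure Ω} [IsProbabilityMeasure P] {ℱ : Filtration ℝ m}
    {a V : ℝ → Ω → ℝ≥0∞} (hV : IsProj P ℱ a V) (ha : IsProg ℱ a)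
    (hfin : ∫⁻ ω, (∫⁻ s in Ioi 0, a s ω) ∂P < ∞) {t : ℝ} (ht : 0 ≤ t) :
    ∀ᵐ ω ∂P, V t ω = ENNReal.ofReal ((P[fun ω => (∫⁻ s in Ioi t, a s ω).toReal | ℱ t]) ω) := by
  have hm : Measurable fun ω => ∫⁻ s in Ioi t, a s ω :=
    measurable_setLIntegral_left ha.measurable_uncurry _
  have hf : ∫⁻ ω, (∫⁻ s in Ioi t, a s ω) ∂P ≠ ∞ := ne_top_of_le_ne_top hfin.ne
    (lintegral_mono fun ω => lintegral_mono_set (Ioi_subset_Ioi ht))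
  filter_upwards [hV.ae_eq t ht, toReal_condLExp (ℱ t) hm.aemeasurable hf,
    hV.ae_lt_top ha hfin ht] with ω h1 h2 h3
  rw [← h2, ← h1, ENNReal.ofReal_toReal h3.ne]

theorem hEZ_ofReal (ρ u : ℝ) (w : ℝ≥0∞) :
    hEZ ρ (ENNReal.ofReal u) w = ENNReal.ofReal u * w ^ ρ := by
  rw [hEZ, if_neg ENNReal.ofReal_ne_top]

/-- **Existence under a one-sided bound when `ρ < 0`.** Let `θ ∈ (0,1)`, `ρ = (θ-1)/θ < 0`,
`Λ ∈ L̂^θ_{++}` and let `U` be nonnegative progressively measurable with `U ≤ KΛ`. Then the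
operator `F_U(W)_t = E[∫_t^∞ h_EZ(U_s, W_s) ds | 𝓕_t]` has a fixed point `W` with
`E[∫₀^∞ h_EZ(U_s,W_s) ds] < ∞`, unique among all such fixed points up to
indistinguishability. -/
theorem existence_one_sided_bound
    (P : Measure Ω) [IsProbabilityMeasure P] (ℱ : Filtration ℝ m)
    (θ ρ : ℝ) (hθ : 0 < θ) (hθ1 : θ < 1) (hρ : ρ = (θ - 1) / θ)
    (Λ : ℝ → Ω → ℝ) (hΛ : MemLthetaHat P ℱ θ Λ)
    (U : ℝ → Ω → ℝ) (hUprog : ProgMeasurable ℱ U) (hUpos : ∀ t ω, 0 ≤ U t ω)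
    (K : ℝ) (hK : 0 < K) (hUK : ∀ t ω, 0 ≤ t → U t ω ≤ K * Λ t ω) :
    ∃ W : ℝ → Ω → ENNReal,
      ProgMeasurable ℱ W ∧
      (∫⁻ ω, (∫⁻ s in Set.Ioi (0:ℝ), hEZ ρ (ENNReal.ofReal (U s ω)) (W s ω)) ∂P) < ⊤ ∧
      (∀ t : ℝ, 0 ≤ t →
        W t =ᵐ[P] condExpENN P (ℱ t)
          fun ω => ∫⁻ s in Set.Ioi t, hEZ ρ (ENNReal.ofReal (U s ω)) (W s ω)) ∧
      ∀ W' : ℝ → Ω → ENNReal,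
        ProgMeasurable ℱ W' →
        (∫⁻ ω, (∫⁻ s in Set.Ioi (0:ℝ), hEZ ρ (ENNReal.ofReal (U s ω)) (W' s ω)) ∂P) < ⊤ →
        (∀ t : ℝ, 0 ≤ t →
          W' t =ᵐ[P] condExpENN P (ℱ t)
            fun ω => ∫⁻ s in Set.Ioi t, hEZ ρ (ENNReal.ofReal (U s ω)) (W' s ω)) →
        ∀ t : ℝ, 0 ≤ t → W' t =ᵐ[P] W t := by
  obtain ⟨⟨hΛprog, hΛpos, hΛfin⟩, -, -, k, K', hk, hkK', hkI⟩ := hΛ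
  have hρ0 : ρ < 0 := hρ ▸ div_neg_of_neg_of_pos (by linarith) hθ
  have hθρ : θ * (1 - ρ) = 1 := by
    rw [hρ]
    field_simp
    ring
  have hK'0 : 0 < K' := hk.trans_le hkK'
  set u : ℝ → Ω → ℝ≥0∞ := fun s ω => ENNReal.ofReal (U s ω) with hudef
  set ℓ : ℝ → Ω → ℝ≥0∞ := fun s ω => ENNReal.ofReal (Λ s ω ^ θ) with hℓdef
  have hu : IsProg ℱ u := IsProg.of_isStronglyProgressive hUprog ENNReal.measurable_ofReal
  have hℓ : IsProg ℱ ℓ := IsProg.of_isStronglyProgressive hΛprog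
    (g := fun x => ENNReal.ofReal (x ^ θ)) (by fun_prop)
  have hΛθ (s : ℝ) (ω : Ω) : 0 < Λ s ω ^ θ := Real.rpow_pos_of_pos (hΛpos s ω) _
  obtain ⟨I, hI⟩ := exists_isProj hℓ hΛfin
  have hIeq (t : ℝ) (ht : 0 ≤ t) : ∀ᵐ ω ∂P, I t ω = ENNReal.ofReal (Iproc P ℱ θ Λ t ω) := by
    have e : (fun ω => ∫ s in Ioi t, Λ s ω ^ θ) = fun ω => (∫⁻ s in Ioi t, ℓ s ω).toReal := by
      funext ω
      refine integral_eq_lintegral_of_nonneg_ae (ae_of_all _ fun s => (hΛθ s ω).le) ?_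
      have := (hℓ.measurable_path ω).ennreal_toReal
      simp only [hℓdef, ENNReal.toReal_ofReal (hΛθ _ ω).le] at this
      exact this.aestronglyMeasurable
    rw [Iproc, e]
    exact hI.ae_eq_ofReal_condExp hℓ hΛfin ht
  have hIℓ (t : ℝ) (ht : 0 ≤ t) : ∀ᵐ ω ∂P,
      I t ω ≤ ENNReal.ofReal k⁻¹ * ℓ t ω ∧ ℓ t ω ≤ K'.toNNReal * I t ω := by
    filter_upwards [hIeq t ht, hkI t ht] with ω h1 h2
    rw [h1, hℓdef]
    dsimp only
    change _ ∧ _ ≤ ENNReal.ofReal K' * _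
    rw [← ENNReal.ofReal_mul (inv_nonneg.2 hk.le), ← ENNReal.ofReal_mul hK'0.le]
    refine ⟨ENNReal.ofReal_le_ofReal ?_, ENNReal.ofReal_le_ofReal h2.2⟩
    rw [← div_eq_inv_mul, le_div_iff₀' hk]
    exact h2.1
  have hIfin : ∫⁻ ω, (∫⁻ s in Ioi 0, I s ω) ∂P < ∞ := by
    have h := lintegral_mul_tail_mono (P := P) (Z := fun _ => 1) measurable_const
      hI.isProg.measurable_uncurry
      (g := fun s ω => ENNReal.ofReal k⁻¹ * ℓ s ω) (hℓ.measurable_uncurry.const_mul _) (t := 0) <| by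
        filter_upwards [ae_restrict_mem measurableSet_Ioi] with s (hs : 0 < s)
        exact (hIℓ s hs.le).mono fun ω hω => hω.1
    simp only [one_mul] at h
    refine lt_of_le_of_lt h ?_
    simp_rw [lintegral_const_mul _ (hℓ.measurable_path _)]
    rw [lintegral_const_mul _ (measurable_setLIntegral_left hℓ.measurable_uncurry _)]
    exact ENNReal.mul_lt_top ENNReal.ofReal_lt_top hΛfin
  have huℓ (s : ℝ) (ω : Ω) (hs : 0 ≤ s) : u s ω ≤ K.toNNReal * ℓ s ω ^ (1 - ρ) := by
    rw [hℓdef, hudef]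
    dsimp only
    rw [ENNReal.ofReal_rpow_of_pos (hΛθ s ω), ← Real.rpow_mul (hΛpos s ω).le, hθρ, Real.rpow_one]
    refine (ENNReal.ofReal_le_ofReal (hUK s ω hs)).trans (le_of_eq ?_)
    rw [ENNReal.ofReal_mul hK.le]
    rfl
  have hb {V : ℝ → Ω → ℝ≥0∞} (hV : IsProg ℱ V) : IsProg ℱ fun s ω => u s ω * V s ω ^ ρ :=
    hu.mul (hV.comp (g := fun x => x ^ ρ) (by fun_prop))
  have hcond {V : ℝ → Ω → ℝ≥0∞} (hV : IsProg ℱ V) (t : ℝ) :=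
    condExpENN_ae_eq_condLExp P (ℱ.le t) (X := fun ω => ∫⁻ s in Ioi t, u s ω * V s ω ^ ρ)
      (measurable_setLIntegral_left (hb hV).measurable_uncurry _)
  obtain ⟨W, hW, hWfin⟩ := exists_isProj_rpow hℓ hI hΛfin hIfin
    (fun s ω => by simpa [hℓdef] using hΛθ s ω) (fun s ω => ENNReal.ofReal_ne_top) hρ0
    (by simpa using hK'0) (fun t ht => (hIℓ t ht).mono fun ω hω => hω.2) hu
    (fun s ω => ENNReal.ofReal_ne_top) huℓ
  simp only [hEZ_ofReal]
  refine ⟨W, hW.isProg.isStronglyProgressive, hWfin, fun t ht =>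
    (hW.ae_eq t ht).trans (hcond hW.isProg t).symm, fun W' hW'prog hW'fin hW'eq t ht => ?_⟩
  have hW'p : IsProg ℱ W' := IsProg.of_isStronglyProgressive hW'prog measurable_id
  have hW' : IsProj P ℱ (fun s ω => u s ω * W' s ω ^ ρ) W' :=
    ⟨hW'p, fun t ht => (hW'eq t ht).trans (hcond hW'p t)⟩
  have key {V V' : ℝ → Ω → ℝ≥0∞} (hV : IsProj P ℱ (fun s ω => u s ω * V s ω ^ ρ) V)
      (hV' : IsProj P ℱ (fun s ω => u s ω * V' s ω ^ ρ) V')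
      (hVfin : ∫⁻ ω, (∫⁻ s in Ioi 0, u s ω * V s ω ^ ρ) ∂P < ∞)
      (hV'fin : ∫⁻ ω, (∫⁻ s in Ioi 0, u s ω * V' s ω ^ ρ) ∂P < ∞) :
      ∀ᵐ ω ∂P, V' t ω ≤ V t ω :=
    IsProj.comparison (p := fun _ _ => 0) (p' := fun _ _ => 0) (hb hV.isProg) (hb hV'.isProg)
      (IsProg.of_deterministic measurable_const) (IsProg.of_deterministic measurable_const)
      (by simpa using hV) (by simpa using hV') (by simpa using hVfin) (by simpa using hV'fin)
      (fun s ω h => mul_le_mul_right (rpow_le_rpow_of_neg hρ0 h) _)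
      (fun s ω h => mul_le_mul_right (rpow_le_rpow_of_neg hρ0 h) _) (fun _ _ => le_rfl) ht
  filter_upwards [key hW hW' hWfin hW'fin, key hW' hW hW'fin hWfin] with ω h1 h2
  exact le_antisymm h1 h2

end EZSDU
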